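/- arXiv:quant-ph/9704040 — 5 statements merged into one kernel-verified Lean document; each statement's English description precedes it below -/
import Mathlib

section
/- Let k be a positive integer and let ρ be a positive definite state on ℂ^k. Then there exists a sequence (M_n), where M_n is a POVM on (ℂ^k)^{⊗n} (depending on ρ but not on σ), such that (1/n)·D_{M_n}(σ^{⊗n} ‖ ρ^{⊗n}) converges to D(σ ‖ ρ) as n → ∞, and this convergence is uniform over all states σ on ℂ^k. -/
open Matrix Filter ComplexOrder

section Defs

variable {ι : Type*} [Fintype ι] [DecidableEq ι]

/-- Functional calculus for Hermitian matrices: apply `f` to the eigenvalues. -/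
noncomputable def matCFC (f : ℝ → ℝ) (A : Matrix ι ι ℂ) : Matrix ι ι ℂ :=
  if hA : A.IsHermitian then
    (hA.eigenvectorUnitary : Matrix ι ι ℂ) *
      Matrix.diagonal (fun i => (f (hA.eigenvalues i) : ℂ)) *
      star (hA.eigenvectorUnitary : Matrix ι ι ℂ)
  else 0

/-- Matrix logarithm by functional calculus (with the convention `log 0 = 0`,
so that `0 log 0 = 0`). -/
noncomputable def matLog (A : Matrix ι ι ℂ) : Matrix ι ι ℂ := matCFC Real.log A

/-- A state (density matrix): positive semidefinite with trace one. -/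
def IsState (ρ : Matrix ι ι ℂ) : Prop := ρ.PosSemidef ∧ ρ.trace = 1

/-- Quantum relative entropy `D(σ‖ρ) = Tr[σ (log σ - log ρ)]`. -/
noncomputable def qRelEnt (σ ρ : Matrix ι ι ℂ) : ℝ :=
  (σ * (matLog σ - matLog ρ)).trace.re

/-- A POVM: finitely many positive semidefinite matrices summing to the identity. -/
def IsPOVM {J : Type*} [Fintype J] (M : J → Matrix ι ι ℂ) : Prop :=
  (∀ j, (M j).PosSemidef) ∧ ∑ j, M j = 1

/-- A PVM: a POVM consisting of mutually orthogonal projections. -/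
def IsPVM {J : Type*} [Fintype J] (M : J → Matrix ι ι ℂ) : Prop :=
  IsPOVM M ∧ (∀ j, (M j).IsHermitian ∧ M j * M j = M j) ∧
    ∀ j j', j ≠ j' → M j * M j' = 0

/-- Kullback–Leibler divergence of finite probability vectors
(with the convention `0 log 0 = 0`, using `Real.log 0 = 0`). -/
noncomputable def klDiv {J : Type*} [Fintype J] (p q : J → ℝ) : ℝ :=
  ∑ j, p j * Real.log (p j / q j)

/-- The outcome probability `Tr[M ρ]` of a POVM element `M` in the state `ρ`. -/
noncomputable def probOf (M ρ : Matrix ι ι ℂ) : ℝ := (M * ρ).trace.re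

/-- `D_M(σ‖ρ)`: the KL divergence of the outcome distributions of a POVM `M`. -/
noncomputable def Dm {J : Type*} [Fintype J] (M : J → Matrix ι ι ℂ)
    (σ ρ : Matrix ι ι ℂ) : ℝ :=
  klDiv (fun j => probOf (M j) σ) (fun j => probOf (M j) ρ)

/-- A PVM `F` refines a family `E` if every member of `E` is a sum of some members of `F`. -/
def Refines {J K : Type*} [Fintype J] (F : J → Matrix ι ι ℂ) (E : K → Matrix ι ι ℂ) : Prop :=
  ∀ i, ∃ S : Finset J, E i = ∑ j ∈ S, F j

/-- The set of eigenvalues of a Hermitian matrix, as a finite set of reals. -/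
noncomputable def spectrumFinset (A : Matrix ι ι ℂ) : Finset ℝ :=
  letI := Classical.decEq ℝ
  if hA : A.IsHermitian then Finset.image hA.eigenvalues Finset.univ else ∅

/-- The eigenprojection of a Hermitian matrix `A` for the eigenvalue `c`. -/
noncomputable def eigProj (A : Matrix ι ι ℂ) (c : ℝ) : Matrix ι ι ℂ :=
  letI := Classical.decEq ℝ
  matCFC (fun x => if x = c then 1 else 0) A

/-- `F` refines the spectral PVM `E(ρ)` of `ρ`: every eigenprojection of `ρ`
is a sum of some members of `F`. -/
def RefinesSpectral {J : Type*} [Fintype J] (F : J → Matrix ι ι ℂ)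
    (ρ : Matrix ι ι ℂ) : Prop :=
  ∀ c ∈ spectrumFinset ρ, ∃ S : Finset J, eigProj ρ c = ∑ j ∈ S, F j

/-- The pinching (conditional expectation) `𝓔_F(σ) = Σ_j F_j σ F_j` of `σ` by a PVM `F`. -/
noncomputable def pinchPVM {J : Type*} [Fintype J] (F : J → Matrix ι ι ℂ)
    (σ : Matrix ι ι ℂ) : Matrix ι ι ℂ :=
  ∑ j, F j * σ * F j

/-- The pinching `𝓔_τ(σ)` of `σ` by the spectral PVM of `τ`. -/
noncomputable def spectralPinch (τ σ : Matrix ι ι ℂ) : Matrix ι ι ℂ :=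
  ∑ c ∈ spectrumFinset τ, eigProj τ c * σ * eigProj τ c

/-- The support of a matrix, i.e. the range of the associated linear map. -/
noncomputable def matSupp (A : Matrix ι ι ℂ) : Submodule ℂ (ι → ℂ) := LinearMap.range A.mulVecLin

end Defs

/-- The `n`-fold tensor (Kronecker) power `A^{⊗n}` of a `k × k` matrix,
acting on `(ℂ^k)^{⊗n}`. -/
noncomputable def tensPow {k : ℕ} (n : ℕ) (A : Matrix (Fin k) (Fin k) ℂ) :
    Matrix (Fin n → Fin k) (Fin n → Fin k) ℂ :=
  Matrix.of fun x y => ∏ i, A (x i) (y i)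

/-- The algebra of permutation invariant matrices. -/
def symAlg (n k : ℕ) : Subalgebra ℂ (Matrix (Fin n → Fin k) (Fin n → Fin k) ℂ) where
  carrier := {X | ∀ (π : Equiv.Perm (Fin n)) (x y : Fin n → Fin k), X (x ∘ π) (y ∘ π) = X x y}
  mul_mem' := by
    intro X Y hX hY π x y
    simp only [Matrix.mul_apply]
    rw [← Equiv.sum_comp (Equiv.arrowCongr π.symm (Equiv.refl (Fin k)))]
    refine Finset.sum_congr rfl fun z _ => ?_
    have : (Equiv.arrowCongr π.symm (Equiv.refl (Fin k))) z = z ∘ π := by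
      ext i; simp [Equiv.arrowCongr]
    rw [this, hX, hY]
  add_mem' := by
    intro X Y hX hY π x y
    simp only [Matrix.add_apply]
    rw [hX, hY]
  algebraMap_mem' := by
    intro r π x y
    simp only [Matrix.algebraMap_matrix_apply]
    have : (x ∘ π = y ∘ π) ↔ x = y := π.surjective.right_cancellable
    simp [this]

lemma tensPow_mem (n k : ℕ) (A : Matrix (Fin k) (Fin k) ℂ) : tensPow n A ∈ symAlg n k := by
  intro π x y
  simp only [tensPow, Matrix.of_apply, Function.comp]
  exact Equiv.prod_comp π (fun i => A (x i) (y i))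

lemma exists_perm_of_fiber {n : ℕ} {β : Type*} [DecidableEq β] (f g : Fin n → β)
    (h : ∀ b, (Finset.univ.filter fun i => f i = b).card
      = (Finset.univ.filter fun i => g i = b).card) :
    ∃ π : Equiv.Perm (Fin n), g ∘ π = f := by
  have h1 : ∀ b, Nonempty ({i // f i = b} ≃ {i // g i = b}) := by
    intro b
    rw [← Fintype.card_eq, Fintype.card_subtype, Fintype.card_subtype]
    exact h b
  let e' : ∀ b, {i // f i = b} ≃ {i // g i = b} := fun b => (h1 b).some
  refine ⟨(Equiv.sigmaFiberEquiv f).symm.trans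
    ((Equiv.sigmaCongrRight e').trans (Equiv.sigmaFiberEquiv g)), ?_⟩
  ext i
  exact (e' (f i) ⟨i, rfl⟩).2

lemma symAlg_finrank (n k : ℕ) : Module.finrank ℂ (symAlg n k) ≤ (n + 1) ^ (k * k) := by
  classical
  let typ : (Fin n → Fin k) → (Fin n → Fin k) → (Fin k × Fin k → Fin (n + 1)) :=
    fun x y p => ⟨(Finset.univ.filter fun i => (x i, y i) = p).card,
      Nat.lt_succ_of_le ((Finset.card_le_univ _).trans (by simp))⟩
  let Φ : ((Fin k × Fin k → Fin (n + 1)) → ℂ) →ₗ[ℂ]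
      Matrix (Fin n → Fin k) (Fin n → Fin k) ℂ :=
    { toFun := fun f => Matrix.of fun x y => f (typ x y)
      map_add' := by intro f g; ext x y; simp
      map_smul' := by intro c f; ext x y; simp }
  have hle : (symAlg n k).toSubmodule ≤ LinearMap.range Φ := by
    intro X hX
    have hX' : ∀ x y x' y', typ x y = typ x' y' → X x y = X x' y' := by
      intro x y x' y' h
      obtain ⟨π, hπ⟩ := exists_perm_of_fiber (fun i => (x i, y i)) (fun i => (x' i, y' i)) (by
        intro b
        have := congrArg Fin.val (congrFun h b)
        exact this)
      have h1 : x = x' ∘ π := by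
        ext i; have := congrFun hπ i; simp at this; simp [this.1]
      have h2 : y = y' ∘ π := by
        ext i; have := congrFun hπ i; simp at this; simp [this.2]
      rw [h1, h2]
      exact hX π x' y'
    refine ⟨fun t => if h : ∃ q : (Fin n → Fin k) × (Fin n → Fin k), typ q.1 q.2 = t
      then X h.choose.1 h.choose.2 else 0, ?_⟩
    ext x y
    have h : ∃ q : (Fin n → Fin k) × (Fin n → Fin k), typ q.1 q.2 = typ x y := ⟨(x, y), rfl⟩
    simp only [Φ, LinearMap.coe_mk, AddHom.coe_mk, Matrix.of_apply]
    rw [dif_pos h]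
    exact hX' _ _ _ _ h.choose_spec
  calc Module.finrank ℂ (symAlg n k) = Module.finrank ℂ (symAlg n k).toSubmodule := rfl
    _ ≤ Module.finrank ℂ (LinearMap.range Φ) := Submodule.finrank_mono hle
    _ ≤ Module.finrank ℂ ((Fin k × Fin k → Fin (n + 1)) → ℂ) := LinearMap.finrank_range_le Φ
    _ = (n + 1) ^ (k * k) := by simp

section PVM

variable {ι : Type*} [Fintype ι] [DecidableEq ι]

/-- A family of nonzero orthogonal projections in `B` that sums to one. -/
def GoodFam (B : Subalgebra ℂ (Matrix ι ι ℂ)) (J : ℕ) (P : Fin J → Matrix ι ι ℂ) : Prop :=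
  (∀ j, (P j).IsHermitian ∧ P j * P j = P j ∧ P j ≠ 0 ∧ P j ∈ B) ∧
    (∀ i j, i ≠ j → P i * P j = 0) ∧ ∑ j, P j = 1

lemma GoodFam.card_le {B : Subalgebra ℂ (Matrix ι ι ℂ)} {J : ℕ} {P : Fin J → Matrix ι ι ℂ}
    (h : GoodFam B J P) : J ≤ Module.finrank ℂ B := by
  have hli : LinearIndependent ℂ (fun j => (⟨P j, (h.1 j).2.2.2⟩ : B)) := by
    rw [Fintype.linearIndependent_iff]
    intro g hg i
    have h1 := congrArg (fun b : B => P i * (b : Matrix ι ι ℂ)) hg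
    simp only [AddSubmonoidClass.coe_finsetSum, Finset.mul_sum] at h1
    rw [Finset.sum_eq_single i] at h1
    · simp [(h.1 i).2.1, (h.1 i).2.2.1] at h1
      exact h1
    · intro j _ hj
      simp [h.2.1 i j hj.symm]
    · simp
  simpa using hli.fintype_card_le_finrank

lemma exists_subproj (B : Subalgebra ℂ (Matrix ι ι ℂ)) (P Y : Matrix ι ι ℂ)
    (hY : Y.IsHermitian) (hYB : Y ∈ B) (hPY : P * Y = Y) (hYP : Y * P = Y)
    (hns : ¬ ∃ t : ℝ, Y = (t : ℂ) • P) :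
    ∃ Q : Matrix ι ι ℂ, Q.IsHermitian ∧ Q * Q = Q ∧ Q ≠ 0 ∧ Q ∈ B ∧ P * Q = Q ∧ Q * P = Q ∧
      Q ≠ P := by
  classical
  have hY0 : Y ≠ 0 := by
    rintro rfl; exact hns ⟨0, by simp⟩
  obtain ⟨i, hi⟩ : ∃ i, hY.eigenvalues i ≠ 0 := by
    by_contra hcon
    push Not at hcon
    exact hY0 (hY.eigenvalues_eq_zero_iff.mp (funext hcon))
  set y := hY.eigenvalues i with hy
  have hysp : y ∈ spectrum ℝ Y := hY.eigenvalues_mem_spectrum_real i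
  have hsa : IsSelfAdjoint Y := hY.isSelfAdjoint
  have hfin : (spectrum ℝ Y).Finite := Matrix.finite_real_spectrum
  let q0 : Polynomial ℝ := ∏ z ∈ hfin.toFinset.erase y, (Polynomial.X - Polynomial.C z)
  have hq0 : q0.eval y ≠ 0 := by
    simp only [q0, Polynomial.eval_prod, Polynomial.eval_sub, Polynomial.eval_X, Polynomial.eval_C]
    rw [Finset.prod_ne_zero_iff]
    intro z hz
    exact sub_ne_zero.mpr (Finset.ne_of_mem_erase hz).symm
  let q : Polynomial ℝ := Polynomial.X * (Polynomial.C (y * q0.eval y)⁻¹ * q0)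
  have hqy : q.eval y = 1 := by
    simp [q]; field_simp
  have hqz : ∀ z ∈ spectrum ℝ Y, z ≠ y → q.eval z = 0 := by
    intro z hz hzy
    simp only [q, q0, Polynomial.eval_mul, Polynomial.eval_prod]
    have h0 : ∏ j ∈ hfin.toFinset.erase y, Polynomial.eval z (Polynomial.X - Polynomial.C j) = 0 :=
      Finset.prod_eq_zero (i := z) (by simp [hzy, hz]) (by simp)
    rw [h0]
    simp
  have hmem : ∀ r : Polynomial ℝ, Polynomial.aeval Y r ∈ B := by
    intro r
    induction r using Polynomial.induction_on' with
    | add p q hp hq => rw [map_add]; exact B.add_mem hp hq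
    | monomial n a =>
      rw [Polynomial.aeval_monomial]
      refine B.mul_mem ?_ (B.pow_mem hYB n)
      have : algebraMap ℝ (Matrix ι ι ℂ) a = algebraMap ℂ (Matrix ι ι ℂ) (a : ℂ) := by
        ext i j; simp [Matrix.algebraMap_matrix_apply]
      rw [this]
      exact B.algebraMap_mem _
  have hcfc : ∀ r : Polynomial ℝ, cfc r.eval Y = Polynomial.aeval Y r :=
    fun r => cfc_polynomial r Y hsa
  refine ⟨Polynomial.aeval Y q, ?_, ?_, ?_, hmem q, ?_, ?_, ?_⟩
  · rw [← hcfc]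
    exact cfc_predicate (R := ℝ) (p := IsSelfAdjoint) _ Y
  · rw [← map_mul, ← hcfc, ← hcfc]
    refine cfc_congr ?_
    intro z hz
    by_cases h : z = y
    · subst h; simp [hqy]
    · simp [hqz z hz h]
  · intro h0
    have h1 : (1 : ℝ) ∈ spectrum ℝ (cfc q.eval Y) := by
      rw [cfc_map_spectrum (R := ℝ) (p := IsSelfAdjoint) q.eval Y hsa]
      exact ⟨y, hysp, hqy⟩
    rw [hcfc, h0] at h1
    have : Nontrivial (Matrix ι ι ℂ) := ⟨Y, 0, hY0⟩
    rw [spectrum.zero_eq] at h1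
    simp at h1
  · simp only [q, map_mul, Polynomial.aeval_X]
    rw [← mul_assoc, hPY]
  · have : Polynomial.aeval Y q = Polynomial.aeval Y (Polynomial.C (y * q0.eval y)⁻¹ * q0) * Y := by
      rw [show q = (Polynomial.C (y * q0.eval y)⁻¹ * q0) * Polynomial.X from mul_comm _ _]
      rw [map_mul _ _ Polynomial.X, Polynomial.aeval_X]
    rw [this, mul_assoc, hYP]
  · intro hQP
    apply hns
    refine ⟨y, ?_⟩
    have h2 : Polynomial.aeval Y (Polynomial.X * q) = Polynomial.aeval Y (Polynomial.C y * q) := by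
      rw [← hcfc, ← hcfc]
      refine cfc_congr ?_
      intro z hz
      by_cases h : z = y
      · subst h; simp
      · simp [hqz z hz h]
    rw [map_mul _ Polynomial.X q, map_mul _ (Polynomial.C y) q, hQP, Polynomial.aeval_X, hYP,
      Polynomial.aeval_C] at h2
    rw [h2]
    ext a b
    simp [Algebra.algebraMap_eq_smul_one]

lemma GoodFam.split {B : Subalgebra ℂ (Matrix ι ι ℂ)} {J : ℕ} {P : Fin J → Matrix ι ι ℂ}
    (h : GoodFam B J P) (j : Fin J) (Q : Matrix ι ι ℂ) (hQ : Q.IsHermitian) (hQQ : Q * Q = Q)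
    (hQ0 : Q ≠ 0) (hQB : Q ∈ B) (hPQ : P j * Q = Q) (hQP : Q * P j = Q) (hne : Q ≠ P j) :
    ∃ P', GoodFam B (J + 1) P' := by
  obtain ⟨h1, h2, h3⟩ := h
  have hQi : ∀ i, i ≠ j → Q * P i = 0 := by
    intro i hi; rw [← hQP, mul_assoc, h2 j i hi.symm, mul_zero]
  have hiQ : ∀ i, i ≠ j → P i * Q = 0 := by
    intro i hi; rw [← hPQ, ← mul_assoc, h2 i j hi, zero_mul]
  refine ⟨Fin.cons Q (Function.update P j (P j - Q)), ?_, ?_, ?_⟩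
  · rw [Fin.forall_fin_succ]
    refine ⟨⟨hQ, hQQ, hQ0, hQB⟩, fun i => ?_⟩
    rw [Fin.cons_succ]
    by_cases hi : i = j
    · subst hi
      rw [Function.update_self]
      refine ⟨(h1 i).1.sub hQ, ?_, sub_ne_zero.mpr hne.symm, B.sub_mem (h1 i).2.2.2 hQB⟩
      simp [sub_mul, mul_sub, hPQ, hQP, hQQ, (h1 i).2.1]
    · rw [Function.update_of_ne hi]
      exact h1 i
  · rw [Fin.forall_fin_succ]
    constructor
    · rw [Fin.forall_fin_succ]
      refine ⟨by simp, fun i _ => ?_⟩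
      rw [Fin.cons_succ, Fin.cons_zero]
      by_cases hi : i = j
      · subst hi
        rw [Function.update_self, mul_sub, hQP, hQQ, sub_self]
      · rw [Function.update_of_ne hi, hQi i hi]
    · intro i
      rw [Fin.forall_fin_succ]
      constructor
      · intro _
        rw [Fin.cons_succ, Fin.cons_zero]
        by_cases hi : i = j
        · subst hi
          rw [Function.update_self, sub_mul, hPQ, hQQ, sub_self]
        · rw [Function.update_of_ne hi, hiQ i hi]
      · intro l hl
        rw [Fin.cons_succ, Fin.cons_succ]
        have hl' : i ≠ l := fun h => hl (by rw [h])
        by_cases hi : i = j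
        · subst hi
          rw [Function.update_self, Function.update_of_ne hl'.symm, sub_mul, h2 i l hl',
            hQi l hl'.symm, sub_self]
        · rw [Function.update_of_ne hi]
          by_cases hlj : l = j
          · subst hlj
            rw [Function.update_self, mul_sub, h2 i l hl', hiQ i hi, sub_self]
          · rw [Function.update_of_ne hlj, h2 i l hl']
  · rw [Fin.sum_univ_succ]
    simp only [Fin.cons_zero, Fin.cons_succ]
    rw [Finset.sum_update_of_mem (Finset.mem_univ j), ← h3,
      ← Finset.add_sum_erase _ _ (Finset.mem_univ j), Finset.sdiff_singleton_eq_erase]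
    abel

lemma exists_maxFam [Nonempty ι] (B : Subalgebra ℂ (Matrix ι ι ℂ)) :
    ∃ J P, GoodFam B J P ∧ ∀ j (X : Matrix ι ι ℂ), X.IsHermitian → X ∈ B →
      ∃ t : ℝ, P j * X * P j = (t : ℂ) • P j := by
  classical
  have hone : ∃ P, GoodFam B 1 P := by
    refine ⟨fun _ => 1, ?_, ?_, ?_⟩
    · intro _
      exact ⟨Matrix.isHermitian_one, mul_one _, one_ne_zero, B.one_mem⟩
    · intro i j hij
      exact absurd (Subsingleton.elim i j) hij
    · simp
  let p : ℕ → Prop := fun J => ∃ P, GoodFam B J P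
  have hle : 1 ≤ Module.finrank ℂ B := hone.choose_spec.card_le
  obtain ⟨P, hP⟩ : p (Nat.findGreatest p (Module.finrank ℂ B)) :=
    Nat.findGreatest_spec (P := p) hle hone
  refine ⟨_, P, hP, ?_⟩
  intro j X hX hXB
  by_contra hns
  obtain ⟨hh, hi, h0, hB⟩ := hP.1 j
  obtain ⟨Q, hQ, hQQ, hQ0, hQB, hPQ, hQP, hne⟩ := exists_subproj B (P j) (P j * X * P j)
    (by
      have := Matrix.isHermitian_conjTranspose_mul_mul (P j) hX
      rwa [hh.eq] at this)
    (B.mul_mem (B.mul_mem hB hXB) hB)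
    (by rw [← mul_assoc, ← mul_assoc, hi]) (by rw [mul_assoc, hi]) hns
  obtain ⟨P', hP'⟩ := hP.split j Q hQ hQQ hQ0 hQB hPQ hQP hne
  have := Nat.le_findGreatest (P := p) hP'.card_le ⟨P', hP'⟩
  omega

end PVM

lemma exists_pvm (n k : ℕ) (hk : 0 < k) (R : Matrix (Fin n → Fin k) (Fin n → Fin k) ℂ)
    (hR : R.IsHermitian) (hRs : R ∈ symAlg n k) :
    ∃ (J : ℕ) (P : Fin J → Matrix (Fin n → Fin k) (Fin n → Fin k) ℂ),
      J ≤ (n + 1) ^ (k * k) ∧ GoodFam (symAlg n k) J P ∧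
      (∀ j, ∃ c : ℝ, P j * R = (c : ℂ) • P j) ∧
      ∀ j X, X.IsHermitian → X ∈ symAlg n k → ∃ t : ℝ, P j * X * P j = (t : ℂ) • P j := by
  have : Nonempty (Fin k) := ⟨⟨0, hk⟩⟩
  obtain ⟨J, P, hP, hmin⟩ := exists_maxFam (symAlg n k ⊓ Subalgebra.centralizer ℂ {R})
  have hG : GoodFam (symAlg n k) J P :=
    ⟨fun j => ⟨(hP.1 j).1, (hP.1 j).2.1, (hP.1 j).2.2.1, (hP.1 j).2.2.2.1⟩, hP.2⟩
  have hcomm : ∀ j, R * P j = P j * R := by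
    intro j
    have := (hP.1 j).2.2.2.2
    exact this R rfl
  have hc : ∀ j, ∃ c : ℝ, P j * R = (c : ℂ) • P j := by
    intro j
    obtain ⟨c, hc⟩ := hmin j R hR ⟨hRs, by rintro _ rfl; rfl⟩
    refine ⟨c, ?_⟩
    rw [← hc, mul_assoc, hcomm, ← mul_assoc, (hP.1 j).2.1]
  refine ⟨J, P, hG.card_le.trans (symAlg_finrank n k), hG, hc, ?_⟩
  intro j X hX hXs
  obtain ⟨c, hc⟩ := hc j
  obtain ⟨hh, hi, h0, hB, -⟩ := hP.1 j
  obtain ⟨t, ht⟩ := hmin j (P j * X * P j)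
    (by
      have := Matrix.isHermitian_conjTranspose_mul_mul (P j) hX
      rwa [hh.eq] at this)
    ⟨mul_mem (mul_mem hB hXs) hB, by
      rintro _ rfl
      rw [mul_assoc _ (P j) _, hc, mul_assoc, ← mul_assoc _ (P j), hcomm, hc,
        Matrix.smul_mul, Matrix.mul_smul, mul_assoc]⟩
  refine ⟨t, ?_⟩
  rw [← ht]
  rw [← mul_assoc, ← mul_assoc, hi, mul_assoc _ (P j) (P j), hi]

lemma classical_bound {A J : Type*} [Fintype A] [Fintype J] (s : A → ℝ) (w : A → J → ℝ)
    (t : J → ℝ) (hs : ∀ a, 0 ≤ s a) (hw : ∀ a j, 0 ≤ w a j) (hw1 : ∀ a, ∑ j, w a j = 1)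
    (hs1 : ∑ a, s a = 1) (h : ∀ a j, s a * w a j ≤ t j)
    (ht : ∑ a, ∑ j, w a j * t j = 1) :
    0 ≤ (∑ a, s a * Real.log (s a)) - ∑ j, (∑ a, s a * w a j) * Real.log (t j) ∧
    (∑ a, s a * Real.log (s a)) - ∑ j, (∑ a, s a * w a j) * Real.log (t j)
      ≤ Real.log (Fintype.card J) := by
  have key : (∑ a, s a * Real.log (s a)) - ∑ j, (∑ a, s a * w a j) * Real.log (t j)
      = ∑ a, ∑ j, s a * w a j * (Real.log (s a) - Real.log (t j)) := by
    have h1 : ∀ a, s a * Real.log (s a) = ∑ j, s a * w a j * Real.log (s a) := by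
      intro a
      rw [← Finset.sum_mul, ← Finset.mul_sum, hw1, mul_one]
    simp_rw [mul_sub, Finset.sum_sub_distrib, ← h1, Finset.sum_mul]
    rw [Finset.sum_comm]
  rw [key]
  constructor
  · have h0 : (0 : ℝ) = ∑ a, ∑ j, (s a * w a j - w a j * t j) := by
      simp_rw [Finset.sum_sub_distrib, ht, ← Finset.mul_sum, hw1, mul_one, hs1, sub_self]
    rw [h0]
    refine Finset.sum_le_sum fun a _ => Finset.sum_le_sum fun j _ => ?_
    have hsw := h a j
    rcases (mul_nonneg (hs a) (hw a j)).eq_or_lt with h1 | h1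
    · rw [← h1] at hsw ⊢
      have := mul_nonneg (hw a j) hsw
      linarith
    · have hsa : 0 < s a := lt_of_le_of_ne (hs a) (by rintro h2; simp [← h2] at h1)
      have htj : 0 < t j := lt_of_lt_of_le h1 hsw
      have := Real.one_sub_inv_le_log_of_pos (div_pos hsa htj)
      rw [Real.log_div hsa.ne' htj.ne', inv_div] at this
      have h3 := mul_le_mul_of_nonneg_left this h1.le
      refine le_trans (le_of_eq ?_) h3
      field_simp
  · have hA : Nonempty A := by
      by_contra hne
      rw [not_nonempty_iff] at hne
      simp at hs1
    have hJ : Nonempty J := by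
      by_contra hne
      rw [not_nonempty_iff] at hne
      have := hw1 hA.some
      simp at this
    have hc : (0 : ℝ) < Fintype.card J := by exact_mod_cast Fintype.card_pos
    have h0 : Real.log (Fintype.card J) =
      ∑ a, ∑ j : J, s a * (w a j * Real.log (Fintype.card J) + (1 / Fintype.card J - w a j)) := by
      simp_rw [← Finset.mul_sum, Finset.sum_add_distrib, Finset.sum_sub_distrib, ← Finset.sum_mul,
        hw1]
      simp [hc.ne', ← Finset.sum_mul, hs1]
    rw [h0]
    refine Finset.sum_le_sum fun a _ => Finset.sum_le_sum fun j _ => ?_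
    have hsw := h a j
    rw [mul_assoc]
    refine le_trans (b := s a * (w a j * (- Real.log (w a j)))) ?_
      (mul_le_mul_of_nonneg_left ?_ (hs a))
    rotate_left
    · rcases (hw a j).eq_or_lt with h1 | h1
      · rw [← h1]; simp
      · have := Real.one_sub_inv_le_log_of_pos (mul_pos h1 hc)
        rw [Real.log_mul h1.ne' hc.ne'] at this
        have h3 := mul_le_mul_of_nonneg_left this h1.le
        have h4 : w a j * (1 - (w a j * Fintype.card J)⁻¹) = w a j - 1 / Fintype.card J := by
          field_simp
        rw [h4] at h3
        linarith
    · rcases (mul_nonneg (hs a) (hw a j)).eq_or_lt with h1 | h1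
      · rw [← mul_assoc, ← mul_assoc, ← h1]; simp
      · have hsa : 0 < s a := lt_of_le_of_ne (hs a) (by rintro h2; simp [← h2] at h1)
        have hwa : 0 < w a j := lt_of_le_of_ne (hw a j) (by rintro h2; simp [← h2] at h1)
        rw [← mul_assoc, ← mul_assoc]
        refine mul_le_mul_of_nonneg_left ?_ h1.le
        have := Real.log_le_log h1 hsw
        rw [Real.log_mul hsa.ne' hwa.ne'] at this
        linarith

lemma sum_tens {K : Type*} [CommRing K] {k : ℕ} (n : ℕ) (f g : Fin k → K) (hg : ∑ a, g a = 1) :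
    ∑ b : Fin n → Fin k, (∑ i, f (b i)) * ∏ i, g (b i) = n * ∑ a, f a * g a := by
  simp_rw [Finset.sum_mul]
  rw [Finset.sum_comm]
  have : ∀ i : Fin n, ∑ b : Fin n → Fin k, f (b i) * ∏ l, g (b l) = ∑ a, f a * g a := by
    intro i
    have h1 : ∀ b : Fin n → Fin k, f (b i) * ∏ l, g (b l)
        = ∏ l, (if l = i then f (b l) * g (b l) else g (b l)) := by
      intro b
      rw [← Finset.mul_prod_erase _ _ (Finset.mem_univ i),
        ← Finset.mul_prod_erase _ _ (Finset.mem_univ i), if_pos rfl, mul_assoc]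
      congr 2
      refine Finset.prod_congr rfl fun l hl => ?_
      rw [if_neg (Finset.ne_of_mem_erase hl)]
    simp_rw [h1]
    have h2 := Finset.prod_univ_sum (fun _ : Fin n => (Finset.univ : Finset (Fin k)))
      (fun l a => if l = i then f a * g a else g a)
    rw [Fintype.piFinset_univ] at h2
    rw [← h2, ← Finset.mul_prod_erase _ _ (Finset.mem_univ i), Finset.prod_eq_one]
    · simp
    · intro l hl
      simp [Finset.ne_of_mem_erase hl, hg]
  simp [this]

lemma sum_prod_one {K : Type*} [CommRing K] {k : ℕ} (n : ℕ) (g : Fin k → K) (hg : ∑ a, g a = 1) :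
    ∑ b : Fin n → Fin k, ∏ i, g (b i) = 1 := by
  have h2 := Finset.prod_univ_sum (fun _ : Fin n => (Finset.univ : Finset (Fin k)))
      (fun _ a => g a)
  rw [Fintype.piFinset_univ] at h2
  rw [← h2]; simp [hg]

lemma sum_tens_log {k : ℕ} (n : ℕ) (s : Fin k → ℝ) (hs : ∑ a, s a = 1) :
    ∑ b : Fin n → Fin k, (∏ i, s (b i)) * Real.log (∏ i, s (b i))
      = n * ∑ a, s a * Real.log (s a) := by
  have h1 : ∀ b : Fin n → Fin k, (∏ i, s (b i)) * Real.log (∏ i, s (b i))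
      = (∑ i, Real.log (s (b i))) * ∏ i, s (b i) := by
    intro b
    by_cases h : ∀ i, s (b i) ≠ 0
    · rw [Real.log_prod (fun i _ => h i), mul_comm]
    · push Not at h
      obtain ⟨i, hi⟩ := h
      rw [Finset.prod_eq_zero (Finset.mem_univ i) hi]; simp
  simp_rw [h1]
  rw [sum_tens n (fun a => Real.log (s a)) s hs]
  simp_rw [mul_comm]

lemma tensPow_mul {k : ℕ} (n : ℕ) (A B : Matrix (Fin k) (Fin k) ℂ) :
    tensPow n (A * B) = tensPow n A * tensPow n B := by
  ext x y
  simp only [tensPow, Matrix.of_apply, Matrix.mul_apply, ← Finset.prod_mul_distrib]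
  have h2 := Finset.prod_univ_sum (fun _ : Fin n => (Finset.univ : Finset (Fin k)))
    (fun i z => A (x i) z * B z (y i))
  rw [Fintype.piFinset_univ] at h2
  exact h2

lemma tensPow_diagonal {k : ℕ} (n : ℕ) (d : Fin k → ℂ) :
    tensPow n (Matrix.diagonal d) = Matrix.diagonal (fun b => ∏ i, d (b i)) := by
  ext x y
  simp only [tensPow, Matrix.of_apply]
  by_cases h : x = y
  · subst h; simp
  · rw [Matrix.diagonal_apply_ne _ h]
    obtain ⟨i, hi⟩ := Function.ne_iff.mp h
    exact Finset.prod_eq_zero (Finset.mem_univ i) (Matrix.diagonal_apply_ne _ hi)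

lemma tensPow_one {k : ℕ} (n : ℕ) : tensPow n (1 : Matrix (Fin k) (Fin k) ℂ) = 1 := by
  rw [← Matrix.diagonal_one, tensPow_diagonal]
  simp

lemma tensPow_star {k : ℕ} (n : ℕ) (A : Matrix (Fin k) (Fin k) ℂ) :
    star (tensPow n A) = tensPow n (star A) := by
  ext x y
  simp [tensPow, Matrix.star_apply]

section Single

variable {ι : Type*} [Fintype ι] [DecidableEq ι]

lemma proj_diag_bounds (Q : Matrix ι ι ℂ) (hQ : Q.IsHermitian) (hQQ : Q * Q = Q) (hQ0 : Q ≠ 0)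
    (S : ι → ℝ) (hS : ∀ b, 0 ≤ S b) (t : ℝ)
    (ht : Q * Matrix.diagonal (fun b => (S b : ℂ)) * Q = (t : ℂ) • Q) :
    (∀ b, 0 ≤ (Q b b).re) ∧ (∀ b, S b * (Q b b).re ≤ t) ∧ 0 < ∑ b, (Q b b).re ∧
      ∑ b, S b * (Q b b).re = t * ∑ b, (Q b b).re := by
  have hsym : ∀ b c, Q c b = star (Q b c) := fun b c => (hQ.apply c b).symm
  have hre : ∀ b, (Q b b).re = ∑ c, Complex.normSq (Q b c) := by
    intro b
    conv_lhs => rw [← hQQ]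
    rw [Matrix.mul_apply, Complex.re_sum]
    refine Finset.sum_congr rfl fun c _ => ?_
    rw [hsym b c, ← starRingEnd_apply, Complex.mul_conj, Complex.ofReal_re]
  have hre2 : ∀ b, t * (Q b b).re = ∑ c, S c * Complex.normSq (Q b c) := by
    intro b
    have h1 := congrArg (fun M : Matrix ι ι ℂ => (M b b).re) ht
    simp only [Matrix.mul_apply (M := Q * _), Matrix.mul_diagonal, Matrix.smul_apply,
      Complex.re_sum, smul_eq_mul, Complex.re_ofReal_mul] at h1
    rw [← h1]
    refine Finset.sum_congr rfl fun c _ => ?_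
    rw [hsym b c, mul_right_comm, ← starRingEnd_apply, Complex.mul_conj, ← Complex.ofReal_mul,
      Complex.ofReal_re, mul_comm]
  have h0 : ∀ b, 0 ≤ (Q b b).re := by
    intro b; rw [hre]; exact Finset.sum_nonneg fun c _ => Complex.normSq_nonneg _
  have him : ∀ b, Complex.normSq (Q b b) = (Q b b).re ^ 2 := by
    intro b
    have := hsym b b
    have h2 := congrArg Complex.im this
    simp at h2
    have h3 : (Q b b).im = 0 := by linarith
    rw [Complex.normSq_apply, h3]; ring
  have hsq : ∀ b, S b * (Q b b).re ^ 2 ≤ t * (Q b b).re := by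
    intro b
    rw [hre2, ← him]
    exact Finset.single_le_sum (f := fun c => S c * Complex.normSq (Q b c))
      (fun c _ => mul_nonneg (hS c) (Complex.normSq_nonneg _)) (Finset.mem_univ b)
  obtain ⟨b0, hb0⟩ : ∃ b, 0 < (Q b b).re := by
    by_contra hcon
    push Not at hcon
    apply hQ0
    ext b c
    have h1 : ∑ c, Complex.normSq (Q b c) = 0 := by
      rw [← hre]; exact le_antisymm (hcon b) (h0 b)
    rw [Finset.sum_eq_zero_iff_of_nonneg (fun c _ => Complex.normSq_nonneg _)] at h1
    exact Complex.normSq_eq_zero.mp (h1 c (Finset.mem_univ c))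
  have hle : ∀ b, 0 < (Q b b).re → S b * (Q b b).re ≤ t := by
    intro b hb
    have := hsq b
    rw [pow_two, ← mul_assoc] at this
    exact le_of_mul_le_mul_right this hb
  have ht0 : 0 ≤ t := (mul_nonneg (hS b0) hb0.le).trans (hle b0 hb0)
  refine ⟨h0, ?_, ?_, ?_⟩
  · intro b
    rcases (h0 b).eq_or_lt with h | h
    · rw [← h]; simpa using ht0
    · exact hle b h
  · exact Finset.sum_pos' (fun b _ => h0 b) ⟨b0, Finset.mem_univ _, hb0⟩
  · rw [Finset.mul_sum]
    simp_rw [hre2]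
    rw [Finset.sum_comm]
    refine Finset.sum_congr rfl fun c _ => ?_
    rw [← Finset.mul_sum, hre]
    congr 1
    refine Finset.sum_congr rfl fun b _ => ?_
    rw [hsym c b, ← starRingEnd_apply, Complex.normSq_conj]

lemma proj_diag_log (Q : Matrix ι ι ℂ) (hQ0 : Q ≠ 0) (r : ι → ℝ) (hr : ∀ b, 0 < r b) (c : ℝ)
    (hc : Q * Matrix.diagonal (fun b => (r b : ℂ)) = (c : ℂ) • Q) :
    0 < c ∧ Q * Matrix.diagonal (fun b => (Real.log (r b) : ℂ)) = (Real.log c : ℂ) • Q := by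
  have h1 : ∀ a b, Q a b ≠ 0 → r b = c := by
    intro a b hab
    have h2 := congrFun (congrFun hc a) b
    rw [Matrix.mul_diagonal, Matrix.smul_apply, smul_eq_mul, mul_comm] at h2
    exact_mod_cast mul_right_cancel₀ hab h2
  constructor
  · by_contra hcon
    apply hQ0
    ext a b
    by_contra hab
    exact hcon ((h1 a b hab) ▸ hr b)
  · ext a b
    rw [Matrix.mul_diagonal, Matrix.smul_apply, smul_eq_mul]
    by_cases hab : Q a b = 0
    · simp [hab]
    · rw [h1 a b hab, mul_comm]

end Single

lemma herm_decomp {k : ℕ} {A : Matrix (Fin k) (Fin k) ℂ} (hA : A.IsHermitian) :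
    ∃ U : Matrix (Fin k) (Fin k) ℂ, star U * U = 1 ∧ U * star U = 1 ∧
      A = U * Matrix.diagonal (fun i => (hA.eigenvalues i : ℂ)) * star U ∧
      matLog A = U * Matrix.diagonal (fun i => (Real.log (hA.eigenvalues i) : ℂ)) * star U := by
  refine ⟨hA.eigenvectorUnitary, Unitary.coe_star_mul_self _, Unitary.coe_mul_star_self _, ?_, ?_⟩
  · have := hA.spectral_theorem
    rw [Unitary.conjStarAlgAut_apply] at this
    exact this
  · rw [matLog, matCFC, dif_pos hA]

lemma core_bound (k n : ℕ) (ρ σ : Matrix (Fin k) (Fin k) ℂ) (hρ : ρ.PosDef) (hσ : IsState σ)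
    (J : ℕ) (P : Fin J → Matrix (Fin n → Fin k) (Fin n → Fin k) ℂ)
    (hP : ∀ j, (P j).IsHermitian ∧ P j * P j = P j ∧ P j ≠ 0) (hP1 : ∑ j, P j = 1)
    (hc : ∀ j, ∃ c : ℝ, P j * tensPow n ρ = (c : ℂ) • P j)
    (ht : ∀ j, ∃ t : ℝ, P j * tensPow n σ * P j = (t : ℂ) • P j) :
    |Dm P (tensPow n σ) (tensPow n ρ) - n * qRelEnt σ ρ| ≤ Real.log J := by
  choose c hc using hc
  choose t ht using ht
  have hσh : σ.IsHermitian := hσ.1.isHermitian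
  have hρh : ρ.IsHermitian := hρ.isHermitian
  obtain ⟨U, hUU, hUU', hσU, hσL⟩ := herm_decomp hσh
  obtain ⟨U', hU, hU', hρU, hρL⟩ := herm_decomp hρh
  set s := hσh.eigenvalues with hsdef
  set r := hρh.eigenvalues with hrdef
  have hs0 : ∀ a, 0 ≤ s a := fun a => hσ.1.eigenvalues_nonneg a
  have hr0 : ∀ a, 0 < r a := fun a => hρ.eigenvalues_pos a
  have hs1 : ∑ a, s a = 1 := by
    have h1 := hσ.2
    rw [hσU, Matrix.trace_mul_comm, ← mul_assoc, hUU, one_mul, Matrix.trace_diagonal] at h1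
    exact_mod_cast h1
  -- tensor powers
  set V := tensPow n U with hV
  set W := tensPow n U' with hW
  have hVV : star V * V = 1 := by rw [hV, tensPow_star, ← tensPow_mul, hUU, tensPow_one]
  have hVV' : V * star V = 1 := by rw [hV, tensPow_star, ← tensPow_mul, hUU', tensPow_one]
  have hWW : star W * W = 1 := by rw [hW, tensPow_star, ← tensPow_mul, hU, tensPow_one]
  have hWW' : W * star W = 1 := by rw [hW, tensPow_star, ← tensPow_mul, hU', tensPow_one]
  let S : (Fin n → Fin k) → ℝ := fun b => ∏ i, s (b i)
  let R : (Fin n → Fin k) → ℝ := fun b => ∏ i, r (b i)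
  have hσn : tensPow n σ = V * Matrix.diagonal (fun b => (S b : ℂ)) * star V := by
    conv_lhs => rw [hσU]
    rw [tensPow_mul, tensPow_mul, tensPow_diagonal, hV, tensPow_star]
    simp [S]
  have hρn : tensPow n ρ = W * Matrix.diagonal (fun b => (R b : ℂ)) * star W := by
    conv_lhs => rw [hρU]
    rw [tensPow_mul, tensPow_mul, tensPow_diagonal, hW, tensPow_star]
    simp [R]
  have hS0 : ∀ b, 0 ≤ S b := fun b => Finset.prod_nonneg fun i _ => hs0 _
  have hR0 : ∀ b, 0 < R b := fun b => Finset.prod_pos fun i _ => hr0 _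
  have hS1 : ∑ b, S b = 1 := sum_prod_one n s hs1
  -- conjugated projections
  have conj_cancel : ∀ (Z : Matrix (Fin n → Fin k) (Fin n → Fin k) ℂ), star Z * Z = 1 →
      Z * star Z = 1 → ∀ A B, star Z * A * Z * (star Z * B * Z) = star Z * (A * B) * Z := by
    intro Z _ h2 A B
    calc star Z * A * Z * (star Z * B * Z) = star Z * A * (Z * star Z) * B * Z := by
          simp only [mul_assoc]
      _ = star Z * (A * B) * Z := by rw [h2, mul_one]; simp only [mul_assoc]
  let Q : Fin J → Matrix (Fin n → Fin k) (Fin n → Fin k) ℂ := fun j => star V * P j * V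
  let Q' : Fin J → Matrix (Fin n → Fin k) (Fin n → Fin k) ℂ := fun j => star W * P j * W
  have hQh : ∀ j, (Q j).IsHermitian := fun j =>
    Matrix.isHermitian_conjTranspose_mul_mul V (hP j).1
  have hQQ : ∀ j, Q j * Q j = Q j := by
    intro j
    simp only [Q]
    rw [conj_cancel V hVV hVV', (hP j).2.1]
  have hQ0 : ∀ j, Q j ≠ 0 := by
    intro j h0
    apply (hP j).2.2
    calc P j = (V * star V) * P j * (V * star V) := by rw [hVV']; simp
      _ = V * Q j * star V := by simp only [Q, mul_assoc]
      _ = 0 := by rw [h0]; simp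
  have hQ'0 : ∀ j, Q' j ≠ 0 := by
    intro j h0
    apply (hP j).2.2
    calc P j = (W * star W) * P j * (W * star W) := by rw [hWW']; simp
      _ = W * Q' j * star W := by simp only [Q', mul_assoc]
      _ = 0 := by rw [h0]; simp
  have hdS : Matrix.diagonal (fun b => (S b : ℂ)) = star V * tensPow n σ * V := by
    rw [hσn]
    calc _ = (star V * V) * Matrix.diagonal (fun b => (S b : ℂ)) * (star V * V) := by
          rw [hVV]; simp
      _ = _ := by simp only [mul_assoc]
  have hdR : Matrix.diagonal (fun b => (R b : ℂ)) = star W * tensPow n ρ * W := by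
    rw [hρn]
    calc _ = (star W * W) * Matrix.diagonal (fun b => (R b : ℂ)) * (star W * W) := by
          rw [hWW]; simp
      _ = _ := by simp only [mul_assoc]
  have hQt : ∀ j, Q j * Matrix.diagonal (fun b => (S b : ℂ)) * Q j = (t j : ℂ) • Q j := by
    intro j
    rw [hdS]
    simp only [Q]
    rw [conj_cancel V hVV hVV', conj_cancel V hVV hVV', ht]
    simp
  have hQ'c : ∀ j, Q' j * Matrix.diagonal (fun b => (R b : ℂ)) = (c j : ℂ) • Q' j := by
    intro j
    rw [hdR]
    simp only [Q']
    rw [conj_cancel W hWW hWW', hc]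
    simp
  have hB := fun j => proj_diag_bounds (Q j) (hQh j) (hQQ j) (hQ0 j) S hS0 (t j) (hQt j)
  have hL := fun j => proj_diag_log (Q' j) (hQ'0 j) R hR0 (c j) (hQ'c j)
  have htr : ∀ j, (P j).trace = (Q j).trace := by
    intro j
    simp only [Q]
    rw [Matrix.trace_mul_comm, ← mul_assoc, hVV', one_mul]
  have hd : ∀ j, (P j).trace.re = ∑ b, (Q j b b).re := by
    intro j
    rw [htr, Matrix.trace, Complex.re_sum]; rfl
  have hp : ∀ j, probOf (P j) (tensPow n σ) = ∑ b, S b * (Q j b b).re := by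
    intro j
    have h1 : (P j * tensPow n σ).trace
        = (Q j * Matrix.diagonal (fun b => (S b : ℂ))).trace := by
      rw [hdS]
      simp only [Q]
      rw [conj_cancel V hVV hVV', Matrix.trace_mul_comm _ V, ← mul_assoc, hVV', one_mul]
    rw [probOf, h1, Matrix.trace, Complex.re_sum]
    refine Finset.sum_congr rfl fun b _ => ?_
    rw [Matrix.diag_apply, Matrix.mul_diagonal, mul_comm, Complex.re_ofReal_mul]
  have hq : ∀ j, probOf (P j) (tensPow n ρ) = c j * ∑ b, (Q j b b).re := by
    intro j
    rw [probOf, hc, Matrix.trace_smul, smul_eq_mul, Complex.re_ofReal_mul, hd]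
  have hDm : Dm P (tensPow n σ) (tensPow n ρ)
      = ∑ j, (∑ b, S b * (Q j b b).re) * Real.log (t j)
        - ∑ j, probOf (P j) (tensPow n σ) * Real.log (c j) := by
    rw [Dm, klDiv, ← Finset.sum_sub_distrib]
    refine Finset.sum_congr rfl fun j _ => ?_
    obtain ⟨-, -, hpos, heq⟩ := hB j
    rw [hq, hp, heq]
    by_cases h0 : t j = 0
    · simp [h0]
    · rw [mul_div_mul_right _ _ hpos.ne', Real.log_div h0 (hL j).1.ne']
      ring
  -- the classical bound
  have hQsum : ∀ b, ∑ j, (Q j b b).re = 1 := by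
    intro b
    have h1 : ∑ j, Q j = 1 := by
      simp only [Q]
      rw [← Finset.sum_mul, ← Finset.mul_sum, hP1, mul_one, hVV]
    have h2 := congrArg (fun M : Matrix _ _ ℂ => (M b b).re) h1
    simp only [Matrix.sum_apply, Complex.re_sum, Matrix.one_apply_eq, Complex.one_re] at h2
    exact h2
  have hcl := classical_bound S (fun b j => (Q j b b).re) t hS0 (fun b j => (hB j).1 b) hQsum hS1
    (fun b j => (hB j).2.1 b) (by
      rw [Finset.sum_comm]
      have : ∀ j, ∑ b, (Q j b b).re * t j = ∑ b, S b * (Q j b b).re := by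
        intro j
        rw [(hB j).2.2.2, ← Finset.sum_mul, mul_comm]
      simp_rw [this]
      rw [Finset.sum_comm]
      simp_rw [← Finset.mul_sum, hQsum, mul_one, hS1])
  rw [Fintype.card_fin] at hcl
  have hent : ∑ b, S b * Real.log (S b) = n * ∑ a, s a * Real.log (s a) := sum_tens_log n s hs1
  have hσσ : (σ * matLog σ).trace.re = ∑ a, s a * Real.log (s a) := by
    rw [hσL]
    conv_lhs => enter [1, 1, 1]; rw [hσU]
    rw [← mul_assoc, Matrix.trace_mul_comm]
    have : star U * (U * Matrix.diagonal (fun i => (s i : ℂ)) * star U *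
        (U * Matrix.diagonal (fun i => (Real.log (s i) : ℂ)))) =
        Matrix.diagonal (fun i => ((s i * Real.log (s i) : ℝ) : ℂ)) := by
      calc _ = (star U * U) * Matrix.diagonal (fun i => (s i : ℂ)) * (star U *
          U) * Matrix.diagonal (fun i => (Real.log (s i) : ℂ)) := by simp only [mul_assoc]
        _ = _ := by rw [hUU]; simp
    rw [this, Matrix.trace_diagonal, Complex.re_sum]
    simp only [Complex.ofReal_re]
  -- the `log ρ` part
  let G : Matrix (Fin k) (Fin k) ℂ := star U' * σ * U'
  have hG1 : ∑ a, G a a = 1 := by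
    have : G.trace = 1 := by
      simp only [G]
      rw [Matrix.trace_mul_comm, ← mul_assoc, hU', one_mul, hσ.2]
    exact this
  have hGn : tensPow n G = star W * tensPow n σ * W := by
    simp only [G]
    rw [tensPow_mul, tensPow_mul, ← tensPow_star]
  have hσρ : (σ * matLog ρ).trace = ∑ a, (Real.log (r a) : ℂ) * G a a := by
    rw [hρL, ← mul_assoc, Matrix.trace_mul_comm, ← mul_assoc, ← mul_assoc, Matrix.trace]
    refine Finset.sum_congr rfl fun a _ => ?_
    rw [Matrix.diag_apply, Matrix.mul_diagonal, mul_comm]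
  have hQ'1 : ∑ j, Q' j = 1 := by
    simp only [Q']
    rw [← Finset.sum_mul, ← Finset.mul_sum, hP1, mul_one, hWW]
  have hcross : ∑ j, probOf (P j) (tensPow n σ) * Real.log (c j)
      = n * (σ * matLog ρ).trace.re := by
    have h1 : ∑ j, (Real.log (c j) : ℂ) * (P j * tensPow n σ).trace
        = n * (σ * matLog ρ).trace := by
      have h2 : ∀ j, (Real.log (c j) : ℂ) * (P j * tensPow n σ).trace
          = (Q' j * Matrix.diagonal (fun b => (Real.log (R b) : ℂ)) * tensPow n G).trace := by
        intro j
        rw [(hL j).2, hGn, Matrix.smul_mul, Matrix.trace_smul, smul_eq_mul]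
        simp only [Q']
        rw [conj_cancel W hWW hWW', Matrix.trace_mul_comm _ W, ← mul_assoc, hWW', one_mul]
      simp_rw [h2]
      rw [← Matrix.trace_sum, ← Finset.sum_mul, ← Finset.sum_mul, hQ'1, one_mul, hσρ,
        ← sum_tens n (fun a => (Real.log (r a) : ℂ)) (fun a => G a a) hG1, Matrix.trace]
      refine Finset.sum_congr rfl fun b _ => ?_
      rw [Matrix.diag_apply, Matrix.diagonal_mul]
      simp only [R, tensPow, Matrix.of_apply]
      rw [Real.log_prod (fun i _ => (hr0 _).ne')]
      simp
    have h3 := congrArg Complex.re h1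
    rw [Complex.re_sum, show (n : ℂ) = ((n : ℝ) : ℂ) by simp, Complex.re_ofReal_mul] at h3
    rw [← h3]
    refine Finset.sum_congr rfl fun j _ => ?_
    rw [Complex.re_ofReal_mul, probOf, mul_comm]
  have hfin : Dm P (tensPow n σ) (tensPow n ρ) - n * qRelEnt σ ρ =
      -((∑ b, S b * Real.log (S b)) - ∑ j, (∑ b, S b * (Q j b b).re) * Real.log (t j)) := by
    rw [hDm, hcross, hent, qRelEnt, mul_sub, Matrix.trace_sub, Complex.sub_re, hσσ]
    ring
  rw [hfin, abs_neg, abs_of_nonneg hcl.1]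
  exact hcl.2

lemma rate_tendsto (m : ℕ) :
    Tendsto (fun n : ℕ => (m : ℝ) * Real.log ((n : ℝ) + 1) / n) atTop (nhds 0) := by
  have h1 : Tendsto (fun n : ℕ => Real.log ((n : ℝ) + 1) / ((n : ℝ) + 1)) atTop (nhds 0) := by
    have h := Real.isLittleO_log_id_atTop.tendsto_div_nhds_zero
    have h2 : Tendsto (fun n : ℕ => (n : ℝ) + 1) atTop atTop :=
      tendsto_atTop_add_const_right _ _ tendsto_natCast_atTop_atTop
    exact h.comp h2
  have h3 := (h1.const_mul (2 * (m : ℝ)))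
  rw [mul_zero] at h3
  refine squeeze_zero' (Eventually.of_forall fun n => ?_) ?_ h3
  · have : 0 ≤ Real.log ((n : ℝ) + 1) := Real.log_nonneg (by linarith [n.cast_nonneg (α := ℝ)])
    positivity
  · filter_upwards [eventually_ge_atTop 1] with n hn
    have hn' : (1 : ℝ) ≤ n := by exact_mod_cast hn
    have : 0 ≤ Real.log ((n : ℝ) + 1) := Real.log_nonneg (by linarith)
    rw [mul_assoc, mul_div_assoc, mul_comm 2, mul_assoc]
    refine mul_le_mul_of_nonneg_left ?_ (by positivity)
    rw [div_le_iff₀ (by linarith)]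
    rw [mul_assoc, div_mul_eq_mul_div, le_div_iff₀ (by linarith)]
    nlinarith

/-- For a positive definite state `ρ` on `ℂ^k` there is a sequence of
POVMs `M n` on `(ℂ^k)^{⊗n}`, independent of `σ`, with
`(1/n) D_{M n}(σ^{⊗n}‖ρ^{⊗n}) → D(σ‖ρ)` uniformly over all states `σ`. -/
theorem statement0 (k : ℕ) (hk : 0 < k) (ρ : Matrix (Fin k) (Fin k) ℂ)
    (hρ : IsState ρ) (hρpd : ρ.PosDef) :
    ∃ (m : ℕ → ℕ) (M : ∀ n : ℕ, Fin (m n) → Matrix (Fin n → Fin k) (Fin n → Fin k) ℂ),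
      (∀ n, IsPOVM (M n)) ∧
      (∀ σ : Matrix (Fin k) (Fin k) ℂ, IsState σ →
        Tendsto (fun n : ℕ => (1 / n : ℝ) * Dm (M n) (tensPow n σ) (tensPow n ρ))
          atTop (nhds (qRelEnt σ ρ))) ∧
      (∀ ε > (0 : ℝ), ∃ N : ℕ, ∀ n ≥ N, ∀ σ : Matrix (Fin k) (Fin k) ℂ, IsState σ →
        |(1 / n : ℝ) * Dm (M n) (tensPow n σ) (tensPow n ρ) - qRelEnt σ ρ| < ε) := by
  have hρn : ∀ n, (tensPow n ρ).IsHermitian := by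
    intro n
    have := tensPow_star n ρ
    rw [show star ρ = ρ from hρpd.isHermitian] at this
    exact this
  choose m P hm hG hc ht using fun n => exists_pvm n k hk (tensPow n ρ) (hρn n) (tensPow_mem n k ρ)
  have hmain : ∀ n : ℕ, 1 ≤ n → ∀ σ : Matrix (Fin k) (Fin k) ℂ, IsState σ →
      |(1 / n : ℝ) * Dm (P n) (tensPow n σ) (tensPow n ρ) - qRelEnt σ ρ|
        ≤ ((k * k : ℕ) : ℝ) * Real.log ((n : ℝ) + 1) / n := by
    intro n hn σ hσ
    have hn' : (0 : ℝ) < n := by exact_mod_cast hn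
    have hσn : (tensPow n σ).IsHermitian := by
      have := tensPow_star n σ
      rw [show star σ = σ from hσ.1.isHermitian] at this
      exact this
    have h1 := core_bound k n ρ σ hρpd hσ (m n) (P n)
      (fun j => ⟨((hG n).1 j).1, ((hG n).1 j).2.1, ((hG n).1 j).2.2.1⟩) (hG n).2.2 (hc n)
      (fun j => ht n j _ hσn (tensPow_mem n k σ))
    have h2 : Real.log (m n) ≤ ((k * k : ℕ) : ℝ) * Real.log ((n : ℝ) + 1) := by
      rcases Nat.eq_zero_or_pos (m n) with h0 | h0
      · rw [h0, Nat.cast_zero, Real.log_zero]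
        exact mul_nonneg (Nat.cast_nonneg _) (Real.log_nonneg (by linarith))
      · rw [← Real.log_pow]
        refine Real.log_le_log (by exact_mod_cast h0) ?_
        exact_mod_cast hm n
    have h3 : (1 / n : ℝ) * Dm (P n) (tensPow n σ) (tensPow n ρ) - qRelEnt σ ρ
        = (Dm (P n) (tensPow n σ) (tensPow n ρ) - n * qRelEnt σ ρ) / n := by
      field_simp
    rw [h3, abs_div, abs_of_pos hn']
    exact div_le_div_of_nonneg_right (h1.trans h2) hn'.le
  have hunif : ∀ ε > (0 : ℝ), ∃ N : ℕ, ∀ n ≥ N, ∀ σ : Matrix (Fin k) (Fin k) ℂ, IsState σ →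
        |(1 / n : ℝ) * Dm (P n) (tensPow n σ) (tensPow n ρ) - qRelEnt σ ρ| < ε := by
    intro ε hε
    obtain ⟨N, hN⟩ := eventually_atTop.mp
      ((eventually_ge_atTop 1).and ((rate_tendsto (k * k)).eventually (gt_mem_nhds hε)))
    refine ⟨N, fun n hn σ hσ => ?_⟩
    obtain ⟨h1, h2⟩ := hN n hn
    exact (hmain n h1 σ hσ).trans_lt h2
  refine ⟨m, P, ?_, ?_, hunif⟩
  · intro n
    refine ⟨fun j => ?_, (hG n).2.2⟩
    obtain ⟨h1, h2, -, -⟩ := (hG n).1 j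
    have := Matrix.posSemidef_conjTranspose_mul_self (P n j)
    rwa [h1.eq, h2] at this
  · intro σ hσ
    rw [Metric.tendsto_atTop]
    intro ε hε
    obtain ⟨N, hN⟩ := hunif ε hε
    exact ⟨N, fun n hn => hN n hn σ hσ⟩
end

section
/- Let σ and ρ be states on ℂ^d with ρ positive definite, and let E = (E_1, …, E_r) be a PVM on ℂ^d such that σ E_i = E_i σ and ρ E_i = E_i ρ for all i; set w(E) := max_i rank(E_i). Let F be a PVM on ℂ^d that refines both E and the spectral PVM E(ρ) of ρ. Then D_F(σ ‖ ρ) ≤ D(σ ‖ ρ) ≤ D_F(σ ‖ ρ) + log w(E). -/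
open Matrix Filter ComplexOrder

theorem aux_real {K J : Type*} [Fintype K] [Fintype J] (s : K → ℝ) (a : K → J → ℝ)
    (n p c T : J → ℝ) (w : ℝ) (hs : ∀ k, 0 ≤ s k) (ha : ∀ k j, 0 ≤ a k j)
    (ha1 : ∀ k, ∑ j, a k j = 1) (hn : ∀ j, ∑ k, a k j = n j)
    (hp : ∀ j, ∑ k, s k * a k j = p j) (hs1 : ∑ k, s k = 1)
    (hc : ∀ j, 0 < c j) (hw : 0 < w) (hT0 : ∀ j, 0 ≤ T j)
    (hT : ∀ j, ∑ k, s k ^ 2 * a k j ≤ p j * T j)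
    (hTw : ∑ j, n j * T j ≤ w) :
    (∑ j, p j * Real.log (p j / (c j * n j)) ≤
      ∑ k, s k * Real.log (s k) - ∑ j, p j * Real.log (c j)) ∧
    (∑ k, s k * Real.log (s k) - ∑ j, p j * Real.log (c j) ≤
      ∑ j, p j * Real.log (p j / (c j * n j)) + Real.log w) := by
  have hn0 : ∀ j, 0 ≤ n j := fun j => hn j ▸ Finset.sum_nonneg fun k _ => ha k j
  have hp0 : ∀ j, 0 ≤ p j := fun j => hp j ▸ Finset.sum_nonneg fun k _ => mul_nonneg (hs k) (ha k j)
  have hnpos : ∀ k j, 0 < a k j → 0 < n j := fun k j h => by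
    rw [← hn j]; exact Finset.sum_pos' (fun k _ => ha k j) ⟨k, Finset.mem_univ _, h⟩
  have hppos : ∀ k j, 0 < s k → 0 < a k j → 0 < p j := fun k j h h' => by
    rw [← hp j]
    exact Finset.sum_pos' (fun k _ => mul_nonneg (hs k) (ha k j)) ⟨k, Finset.mem_univ _, mul_pos h h'⟩
  have hsa : ∑ k, ∑ j, s k * a k j = 1 := by
    rw [← hs1]; refine Finset.sum_congr rfl fun k _ => ?_
    rw [← Finset.mul_sum, ha1, mul_one]
  have hp1 : ∑ j, p j = 1 := by
    rw [← hsa, Finset.sum_comm]; exact Finset.sum_congr rfl fun j _ => (hp j).symm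
  have hD : ∑ j, p j * Real.log (p j / (c j * n j)) =
      ∑ j, p j * Real.log (p j / n j) - ∑ j, p j * Real.log (c j) := by
    rw [← Finset.sum_sub_distrib]
    refine Finset.sum_congr rfl fun j _ => ?_
    rcases (hp0 j).eq_or_lt with h | h
    · simp [← h]
    have hnj : 0 < n j := by
      rcases (hn0 j).eq_or_lt with h' | h'
      · exfalso
        have : ∀ k, a k j = 0 := by
          intro k
          by_contra hk
          exact (hnpos k j (lt_of_le_of_ne (ha k j) (Ne.symm hk))).ne h'
        have h2 := hp j
        simp [this] at h2
        exact h.ne h2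
      · exact h'
    rw [Real.log_div h.ne' (mul_pos (hc j) hnj).ne', Real.log_div h.ne' hnj.ne',
      Real.log_mul (hc j).ne' hnj.ne']
    ring
  have hA : ∑ k, s k * Real.log (s k) = ∑ k, ∑ j, s k * a k j * Real.log (s k) := by
    refine Finset.sum_congr rfl fun k _ => ?_
    rw [← Finset.sum_mul, ← Finset.mul_sum, ha1, mul_one]
  have hB : ∑ j, p j * Real.log (p j / n j) = ∑ k, ∑ j, s k * a k j * Real.log (p j / n j) := by
    rw [Finset.sum_comm]
    refine Finset.sum_congr rfl fun j _ => ?_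
    rw [← Finset.sum_mul, hp]
  have hdiff : ∑ k, s k * Real.log (s k) - ∑ j, p j * Real.log (p j / n j) =
      ∑ k, ∑ j, s k * a k j * (Real.log (s k) - Real.log (p j / n j)) := by
    rw [hA, hB]; simp only [mul_sub, Finset.sum_sub_distrib]
  have hlow : ∀ k j, s k * a k j - a k j * (p j / n j) ≤
      s k * a k j * (Real.log (s k) - Real.log (p j / n j)) := by
    intro k j
    have h0 : 0 ≤ a k j * (p j / n j) := mul_nonneg (ha k j) (div_nonneg (hp0 j) (hn0 j))
    rcases (hs k).eq_or_lt with h | h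
    · simp only [← h]; simp; simpa using h0
    rcases (ha k j).eq_or_lt with h' | h'
    · simp [← h']
    have h1 := hnpos k j h'
    have h2 := hppos k j h h'
    have h3 : 0 < p j / n j := div_pos h2 h1
    have := Real.log_le_sub_one_of_pos (div_pos h3 h)
    rw [Real.log_div h3.ne' h.ne'] at this
    have h4 := mul_le_mul_of_nonneg_left this (mul_pos h h').le
    have h5 : s k * a k j * (p j / n j / s k - 1) = a k j * (p j / n j) - s k * a k j := by
      field_simp
    linarith
  have hup : ∀ k j, s k * a k j * (Real.log (s k) - Real.log (p j / n j)) ≤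
      s k ^ 2 * a k j * (n j / (p j * w)) - s k * a k j + s k * a k j * Real.log w := by
    intro k j
    rcases (hs k).eq_or_lt with h | h
    · simp [← h]
    rcases (ha k j).eq_or_lt with h' | h'
    · simp [← h']
    have h1 := hnpos k j h'
    have h2 := hppos k j h h'
    have h3 : 0 < p j / n j := div_pos h2 h1
    have := Real.log_le_sub_one_of_pos (div_pos (div_pos h h3) hw)
    rw [Real.log_div (div_pos h h3).ne' hw.ne', Real.log_div h.ne' h3.ne'] at this
    have h4 := mul_le_mul_of_nonneg_left this (mul_pos h h').le
    have h5 : s k * a k j * (s k / (p j / n j) / w - 1) =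
      s k ^ 2 * a k j * (n j / (p j * w)) - s k * a k j := by
      field_simp
    linarith
  have hL : ∑ k, ∑ j, a k j * (p j / n j) ≤ 1 := by
    rw [Finset.sum_comm, ← hp1]
    refine Finset.sum_le_sum fun j _ => ?_
    rw [← Finset.sum_mul, hn]
    rcases (hn0 j).eq_or_lt with h | h
    · simp [← h, hp0]
    · rw [mul_div_cancel₀ _ h.ne']
  have hU : ∑ k, ∑ j, s k ^ 2 * a k j * (n j / (p j * w)) ≤ 1 := by
    rw [Finset.sum_comm]
    calc _ ≤ ∑ j, n j * T j / w := by
          refine Finset.sum_le_sum fun j _ => ?_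
          rw [← Finset.sum_mul]
          have h0 : 0 ≤ n j * T j / w := div_nonneg (mul_nonneg (hn0 j) (hT0 j)) hw.le
          rcases (hp0 j).eq_or_lt with h | h
          · simpa [← h] using h0
          refine (mul_le_mul_of_nonneg_right (hT j) (div_nonneg (hn0 j) (mul_pos h hw).le)).trans ?_
          apply le_of_eq; field_simp
      _ ≤ 1 := by rw [← Finset.sum_div]; exact (div_le_one hw).2 hTw
  have e1 := Finset.sum_le_sum fun k (_ : k ∈ Finset.univ) =>
    Finset.sum_le_sum fun j (_ : j ∈ Finset.univ) => hlow k j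
  have e2 := Finset.sum_le_sum fun k (_ : k ∈ Finset.univ) =>
    Finset.sum_le_sum fun j (_ : j ∈ Finset.univ) => hup k j
  simp only [Finset.sum_sub_distrib, Finset.sum_add_distrib, hsa, ← Finset.sum_mul] at e1 e2
  have hU' := hU
  constructor <;> linarith

section Aux
variable {ι : Type*} [Fintype ι] [DecidableEq ι]

theorem matCFC_mul' (f g : ℝ → ℝ) {A : Matrix ι ι ℂ} (hA : A.IsHermitian) :
    matCFC f A * matCFC g A = matCFC (fun x => f x * g x) A := by
  have h : star (hA.eigenvectorUnitary : Matrix ι ι ℂ) * (hA.eigenvectorUnitary : Matrix ι ι ℂ) = 1 :=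
    Unitary.coe_star_mul_self _
  simp only [matCFC, dif_pos hA]
  set U := (hA.eigenvectorUnitary : Matrix ι ι ℂ)
  calc _ = U * diagonal (fun i => (f (hA.eigenvalues i) : ℂ)) * (star U * U) *
        diagonal (fun i => (g (hA.eigenvalues i) : ℂ)) * star U := by simp only [Matrix.mul_assoc]
    _ = _ := by
      rw [h, Matrix.mul_one, Matrix.mul_assoc U, Matrix.diagonal_mul_diagonal]
      simp

theorem matCFC_id' {A : Matrix ι ι ℂ} (hA : A.IsHermitian) : matCFC (fun x => x) A = A := by
  simp only [matCFC, dif_pos hA]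
  conv_rhs => rw [hA.spectral_theorem, Unitary.conjStarAlgAut_apply]
  rfl

theorem matCFC_one' {A : Matrix ι ι ℂ} (hA : A.IsHermitian) : matCFC (fun _ => 1) A = 1 := by
  simp only [matCFC, dif_pos hA]
  simp

theorem matCFC_sum' {A : Matrix ι ι ℂ} (hA : A.IsHermitian) {α : Type*} (s : Finset α)
    (f : α → ℝ → ℝ) : ∑ c ∈ s, matCFC (f c) A = matCFC (fun x => ∑ c ∈ s, f c x) A := by
  simp only [matCFC, dif_pos hA]
  rw [← Finset.sum_mul, ← Finset.mul_sum]
  congr 2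
  ext i j
  rw [Matrix.sum_apply]
  by_cases h : i = j
  · subst h; simp
  · simp [h]

theorem matCFC_smul' {A : Matrix ι ι ℂ} (hA : A.IsHermitian) (r : ℝ)
    (f : ℝ → ℝ) : matCFC (fun x => r * f x) A = (r : ℂ) • matCFC f A := by
  simp only [matCFC, dif_pos hA]
  rw [← Matrix.smul_mul, ← Matrix.mul_smul]
  congr 2
  ext i j
  by_cases h : i = j
  · subst h; simp
  · simp [h]

theorem matCFC_congr' {A : Matrix ι ι ℂ} (hA : A.IsHermitian) (f g : ℝ → ℝ)
    (h : ∀ i, f (hA.eigenvalues i) = g (hA.eigenvalues i)) : matCFC f A = matCFC g A := by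
  simp only [matCFC, dif_pos hA, h]

theorem trace_matCFC' (M : Matrix ι ι ℂ) (f : ℝ → ℝ) {A : Matrix ι ι ℂ} (hA : A.IsHermitian) :
    (M * matCFC f A).trace.re = ∑ k, f (hA.eigenvalues k) *
      ((star (hA.eigenvectorUnitary : Matrix ι ι ℂ) * M * hA.eigenvectorUnitary) k k).re := by
  simp only [matCFC, dif_pos hA]
  set U := (hA.eigenvectorUnitary : Matrix ι ι ℂ)
  rw [← Matrix.mul_assoc, Matrix.trace_mul_comm, ← Matrix.mul_assoc, ← Matrix.mul_assoc,
    Matrix.trace, Complex.re_sum]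
  refine Finset.sum_congr rfl fun k _ => ?_
  rw [Matrix.diag_apply, Matrix.mul_diagonal, mul_comm, Complex.re_ofReal_mul]

theorem eigProj_sum' {A : Matrix ι ι ℂ} (hA : A.IsHermitian) :
    ∑ c ∈ spectrumFinset A, eigProj A c = 1 := by
  classical
  unfold eigProj
  rw [matCFC_sum' hA, ← matCFC_one' hA]
  refine matCFC_congr' hA _ _ fun i => ?_
  rw [Finset.sum_ite_eq, if_pos]
  simp [spectrumFinset, hA]

theorem matCFC_mul_eigProj' (f : ℝ → ℝ) {A : Matrix ι ι ℂ} (hA : A.IsHermitian) (c : ℝ) :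
    matCFC f A * eigProj A c = (f c : ℂ) • eigProj A c := by
  unfold eigProj
  rw [matCFC_mul' _ _ hA, ← matCFC_smul' hA]
  refine matCFC_congr' hA _ _ fun i => ?_
  split_ifs with h
  · rw [h]
  · simp

/-- In a PVM, a member times a partial sum. -/
theorem pvm_sum_mul' {J : Type*} [Fintype J] [DecidableEq J] {F : J → Matrix ι ι ℂ} (hF : IsPVM F)
    (S : Finset J) (j : J) :
    (∑ j' ∈ S, F j') * F j = if j ∈ S then F j else 0 := by
  rw [Finset.sum_mul]
  rw [← Finset.sum_ite_eq' S j F]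
  refine Finset.sum_congr rfl fun j' _ => ?_
  split_ifs with h
  · subst h; exact (hF.2.1 _).2
  · exact hF.2.2 _ _ h

theorem exists_eig' {J : Type*} [Fintype J] {F : J → Matrix ι ι ℂ} (hF : IsPVM F)
    {ρ : Matrix ι ι ℂ} (hρ : ρ.PosDef) (h : RefinesSpectral F ρ) (j : J) :
    ∃ c : ℝ, 0 < c ∧ ∀ f : ℝ → ℝ, matCFC f ρ * F j = (f c : ℂ) • F j := by
  classical
  by_cases h0 : F j = 0
  · exact ⟨1, one_pos, fun f => by simp [h0]⟩
  have hA := hρ.isHermitian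
  have h1 : ∃ c ∈ spectrumFinset ρ, eigProj ρ c * F j ≠ 0 := by
    by_contra! hcon
    apply h0
    rw [← Matrix.one_mul (F j), ← eigProj_sum' hA, Finset.sum_mul]
    exact Finset.sum_eq_zero hcon
  obtain ⟨c, hc, hne⟩ := h1
  obtain ⟨S, hS⟩ := h c hc
  have h2 : eigProj ρ c * F j = F j := by
    rw [hS, pvm_sum_mul' hF] at hne ⊢
    split_ifs with hj
    · rfl
    · simp [hj] at hne
  refine ⟨c, ?_, fun f => ?_⟩
  · simp only [spectrumFinset, dif_pos hA, Finset.mem_image] at hc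
    obtain ⟨i, -, rfl⟩ := hc
    exact hρ.eigenvalues_pos i
  · rw [← h2, ← Matrix.mul_assoc, matCFC_mul_eigProj' f hA, Matrix.smul_mul]

theorem diag_conj_nonneg' {F : Matrix ι ι ℂ} (hF : F.PosSemidef) (U : Matrix ι ι ℂ) (k : ι) :
    0 ≤ ((star U * F * U) k k).re := by
  have := (hF.conjTranspose_mul_mul_same U).diag_nonneg (i := k)
  exact (Complex.le_def.1 this).1

theorem trace_sq_le' {F A : Matrix ι ι ℂ} (hF : F.PosSemidef) (hA : A.PosSemidef) :
    (F * (A * A)).trace.re ≤ (F * A).trace.re * A.trace.re := by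
  have hH := hA.isHermitian
  have h1 : A * A = matCFC (fun x => x * x) A := by
    rw [← matCFC_mul' _ _ hH, matCFC_id' hH]
  have h2 := trace_matCFC' F (fun x => x) hH
  rw [matCFC_id' hH] at h2
  have h3 : A.trace.re = ∑ k, hH.eigenvalues k := by
    rw [hH.trace_eq_sum_eigenvalues]; simp
  rw [h1, trace_matCFC' F _ hH, h2, h3, Finset.sum_mul]
  refine Finset.sum_le_sum fun k _ => ?_
  have h4 : hH.eigenvalues k ≤ ∑ k, hH.eigenvalues k :=
    Finset.single_le_sum (fun i _ => hA.eigenvalues_nonneg i) (Finset.mem_univ k)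
  have := mul_le_mul_of_nonneg_left h4 (mul_nonneg (hA.eigenvalues_nonneg k)
    (diag_conj_nonneg' hF hH.eigenvectorUnitary k))
  linarith

theorem trace_eq_rank' {P : Matrix ι ι ℂ} (hP : P * P = P) : P.trace = (P.rank : ℂ) := by
  have h : IsIdempotentElem P.mulVecLin := by
    rw [IsIdempotentElem, Module.End.mul_eq_comp, ← Matrix.mulVecLin_mul, hP]
  have h2 := (LinearMap.IsIdempotentElem.isProj_range _ h).trace
  rw [Matrix.rank, ← h2, ← Matrix.toLin'_apply', Matrix.trace_toLin'_eq]

end Aux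

/-- If states `σ, ρ` (with `ρ` positive definite) commute with a PVM `E`,
and a PVM `F` refines both `E` and the spectral PVM of `ρ`, then
`D_F(σ‖ρ) ≤ D(σ‖ρ) ≤ D_F(σ‖ρ) + log w(E)` where `w(E) = max_i rank(E_i)`. -/
theorem statement2 (d r m : ℕ) (σ ρ : Matrix (Fin d) (Fin d) ℂ)
    (hσ : IsState σ) (hρ : IsState ρ) (hρpd : ρ.PosDef)
    (E : Fin r → Matrix (Fin d) (Fin d) ℂ) (hE : IsPVM E)
    (hσE : ∀ i, σ * E i = E i * σ) (hρE : ∀ i, ρ * E i = E i * ρ)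
    (F : Fin m → Matrix (Fin d) (Fin d) ℂ) (hF : IsPVM F)
    (hFE : Refines F E) (hFρ : RefinesSpectral F ρ) :
    Dm F σ ρ ≤ qRelEnt σ ρ ∧
    qRelEnt σ ρ ≤ Dm F σ ρ + Real.log ((Finset.univ.sup fun i => (E i).rank : ℕ) : ℝ) := by
  classical
  have hH := hσ.1.isHermitian
  have hR := hρpd.isHermitian
  choose c hc hcF using fun j => exists_eig' hF hρpd hFρ j
  choose S hS using hFE
  set U := (hH.eigenvectorUnitary : Matrix (Fin d) (Fin d) ℂ) with hU
  have hUU : star U * U = 1 := Unitary.coe_star_mul_self _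
  have hFs : ∑ j, F j = 1 := hF.1.2
  have hEs : ∑ i, E i = 1 := hE.1.2
  have hσcfc : matCFC (fun x => x) σ = σ := matCFC_id' hH
  have hFH : ∀ j, (F j).IsHermitian := fun j => (hF.2.1 j).1
  have hEps : ∀ i, (E i * σ).PosSemidef := fun i => by
    have h := hσ.1.conjTranspose_mul_mul_same (E i)
    rw [(hE.2.1 i).1.eq, Matrix.mul_assoc, hσE, ← Matrix.mul_assoc, (hE.2.1 i).2] at h
    exact h
  have hEt : ∀ i, 0 ≤ (E i * σ).trace.re := fun i =>
    (Complex.le_def.1 (hEps i).trace_nonneg).1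
  have hn0 : ∀ j, 0 ≤ (F j).trace.re := fun j =>
    (Complex.le_def.1 (hF.1.1 j).trace_nonneg).1
  -- the weights of the blocks of `E`
  have hT : ∀ j, ∃ T : ℝ, 0 ≤ T ∧ (F j * (σ * σ)).trace.re ≤ (F j * σ).trace.re * T ∧
      (F j).trace.re * T ≤ ∑ i, if j ∈ S i then (F j).trace.re * (E i * σ).trace.re else 0 := by
    intro j
    by_cases h0 : F j = 0
    · exact ⟨0, le_rfl, by simp [h0], by simp [h0]⟩
    have h1 : ∃ i, E i * F j ≠ 0 := by
      by_contra! hcon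
      apply h0
      rw [← Matrix.one_mul (F j), ← hEs, Finset.sum_mul]
      exact Finset.sum_eq_zero fun i _ => hcon i
    obtain ⟨i, hi⟩ := h1
    have hj : j ∈ S i := by
      by_contra hj
      apply hi
      rw [hS, pvm_sum_mul' hF, if_neg hj]
    have h2 : E i * F j = F j := by rw [hS, pvm_sum_mul' hF, if_pos hj]
    have h3 : F j * E i = F j := by
      have := congrArg conjTranspose h2
      rwa [conjTranspose_mul, (hFH j).eq, (hE.2.1 i).1.eq] at this
    refine ⟨(E i * σ).trace.re, hEt i, ?_, ?_⟩
    · have h4 := trace_sq_le' (hF.1.1 j) (hEps i)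
      have h5 : F j * (E i * σ) = F j * σ := by rw [← Matrix.mul_assoc, h3]
      have h6 : F j * (E i * σ * (E i * σ)) = F j * (σ * σ) := by
        rw [← Matrix.mul_assoc, h5, Matrix.mul_assoc, ← Matrix.mul_assoc σ, hσE,
          Matrix.mul_assoc, ← Matrix.mul_assoc, h3]
      rwa [h5, h6] at h4
    · have := Finset.single_le_sum (f := fun i => if j ∈ S i then (F j).trace.re * (E i * σ).trace.re else 0)
        (fun i _ => by split_ifs; exacts [mul_nonneg (hn0 j) (hEt i), le_rfl]) (Finset.mem_univ i)
      simpa [hj] using this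
  choose T hT0 hT1 hT2 using hT
  have hrank : ∀ i, ((E i).rank : ℝ) = ∑ j ∈ S i, (F j).trace.re := by
    intro i
    have h := congrArg Complex.re (trace_eq_rank' (hE.2.1 i).2)
    rw [Complex.natCast_re] at h
    rw [← h, hS, Matrix.trace_sum, Complex.re_sum]
  set w : ℕ := Finset.univ.sup fun i => (E i).rank with hwdef
  have hwi : ∀ i, ((E i).rank : ℝ) ≤ w := fun i => by
    exact_mod_cast Finset.le_sup (f := fun i => (E i).rank) (Finset.mem_univ i)
  have hEσ1 : ∑ i, (E i * σ).trace.re = 1 := by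
    rw [← Complex.re_sum, ← Matrix.trace_sum, ← Finset.sum_mul, hEs, Matrix.one_mul, hσ.2]; rfl
  have hTw : ∑ j, (F j).trace.re * T j ≤ w := by
    calc _ ≤ ∑ j, ∑ i, if j ∈ S i then (F j).trace.re * (E i * σ).trace.re else 0 :=
          Finset.sum_le_sum fun j _ => hT2 j
      _ = ∑ i, ((E i).rank : ℝ) * (E i * σ).trace.re := by
          rw [Finset.sum_comm]
          refine Finset.sum_congr rfl fun i _ => ?_
          rw [hrank, Finset.sum_mul, Finset.sum_ite_mem, Finset.univ_inter]
      _ ≤ ∑ i, (w : ℝ) * (E i * σ).trace.re :=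
          Finset.sum_le_sum fun i _ => mul_le_mul_of_nonneg_right (hwi i) (hEt i)
      _ = w := by rw [← Finset.mul_sum, hEσ1, mul_one]
  have hw : (0 : ℝ) < w := by
    rcases Nat.eq_zero_or_pos w with h | h
    · exfalso
      have hr : ∀ i, E i = 0 := fun i => by
        have h1 := hwi i
        rw [h] at h1
        have h2 : (E i).rank = 0 := by
          have : (E i).rank ≤ 0 := by exact_mod_cast h1
          omega
        have h3 : (E i).mulVecLin = 0 := by
          rw [← LinearMap.range_eq_bot]
          exact Submodule.finrank_eq_zero.1 h2
        ext a b
        have h4 := congrFun (LinearMap.congr_fun h3 (Pi.single b 1)) a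
        simpa using h4
      simp [hr] at hEσ1
    · exact_mod_cast h
  have main := aux_real hH.eigenvalues (fun k j => ((star U * F j * U) k k).re)
    (fun j => (F j).trace.re) (fun j => (F j * σ).trace.re) c T w
    hσ.1.eigenvalues_nonneg (fun k j => diag_conj_nonneg' (hF.1.1 j) U k)
    (fun k => by
      rw [← Complex.re_sum, ← Matrix.sum_apply, ← Finset.sum_mul, ← Finset.mul_sum, hFs,
        Matrix.mul_one, hUU]; simp)
    (fun j => by
      have := trace_matCFC' (F j) (fun _ => 1) hH
      rw [matCFC_one' hH] at this
      simpa using this.symm)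
    (fun j => by
      have := trace_matCFC' (F j) (fun x => x) hH
      rw [hσcfc] at this
      exact this.symm)
    (by
      have h := congrArg Complex.re hσ.2
      rw [hH.trace_eq_sum_eigenvalues] at h
      simpa using h)
    hc hw hT0
    (fun j => by
      have := trace_matCFC' (F j) (fun x => x * x) hH
      rw [← matCFC_mul' _ _ hH, hσcfc] at this
      simp only [sq]
      rw [← this]
      exact hT1 j)
    hTw
  have hD : Dm F σ ρ = ∑ j, (F j * σ).trace.re *
      Real.log ((F j * σ).trace.re / (c j * (F j).trace.re)) := by
    unfold Dm klDiv probOf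
    refine Finset.sum_congr rfl fun j _ => ?_
    have h := hcF j (fun x => x)
    rw [matCFC_id' hR] at h
    have h' : (F j * ρ).trace.re = c j * (F j).trace.re := by
      rw [Matrix.trace_mul_comm, h, Matrix.trace_smul, smul_eq_mul, Complex.re_ofReal_mul]
    simp only [h']
  have hQ : qRelEnt σ ρ = ∑ k, hH.eigenvalues k * Real.log (hH.eigenvalues k) -
      ∑ j, (F j * σ).trace.re * Real.log (c j) := by
    unfold qRelEnt matLog
    rw [Matrix.mul_sub, Matrix.trace_sub, Complex.sub_re]
    congr 1
    · have h1 : σ * matCFC Real.log σ = 1 * matCFC (fun x => x * Real.log x) σ := by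
        rw [← matCFC_mul' _ _ hH, hσcfc, Matrix.one_mul]
      rw [h1, trace_matCFC' _ _ hH, Matrix.mul_one, ← hU, hUU]
      simp
    · have h1 : σ * matCFC Real.log ρ = ∑ j, (Real.log (c j) : ℂ) • (σ * F j) := by
        rw [← Matrix.mul_one (matCFC Real.log ρ), ← hFs, Finset.mul_sum, Finset.mul_sum]
        refine Finset.sum_congr rfl fun j _ => ?_
        rw [hcF, Matrix.mul_smul]
      rw [h1, Matrix.trace_sum, Complex.re_sum]
      refine Finset.sum_congr rfl fun j _ => ?_
      rw [Matrix.trace_smul, smul_eq_mul, Complex.re_ofReal_mul, Matrix.trace_mul_comm, mul_comm]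
  rw [hD, hQ]
  exact main
end

section
/- Let σ and ρ be states on ℂ^d with ρ positive definite, and let F = (F_1, …, F_m) be a PVM on ℂ^d that refines the spectral PVM E(ρ) of ρ (equivalently, ρ acts as a scalar on the range of each F_j). Then D(σ ‖ ρ) = D(𝓔_F(σ) ‖ ρ) + D(σ ‖ 𝓔_F(σ)), where 𝓔_F(σ) = Σ_j F_j σ F_j is the pinching of σ by F. -/
open Matrix Filter ComplexOrder

theorem commute_matCFC {ι : Type*} [Fintype ι] [DecidableEq ι] (f : ℝ → ℝ) (A B : Matrix ι ι ℂ)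
    (hA : A.IsHermitian) (hBA : B * A = A * B) : B * matCFC f A = matCFC f A * B := by
  have key : matCFC f A = cfc f A := by
    rw [hA.cfc_eq, Matrix.IsHermitian.cfc, matCFC, dif_pos hA, Unitary.conjStarAlgAut_apply]
    rfl
  rw [key]
  exact ((show Commute A B from hBA.symm).cfc_real f).symm

theorem matCFC_eq_sum {ι : Type*} [Fintype ι] [DecidableEq ι] (f : ℝ → ℝ) (A : Matrix ι ι ℂ)
    (hA : A.IsHermitian) :
    matCFC f A = ∑ c ∈ spectrumFinset A, (f c : ℂ) • eigProj A c := by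
  classical
  simp only [eigProj, matCFC, dif_pos hA]
  have e : ∀ (a : ℂ) (X Y Z : Matrix ι ι ℂ), a • (X * Y * Z) = X * (a • Y) * Z := by
    intro a X Y Z
    rw [Matrix.mul_smul, Matrix.smul_mul]
  simp only [e]
  rw [← Finset.sum_mul, ← Finset.mul_sum]
  congr 2
  ext i j
  rw [Matrix.sum_apply]
  by_cases hij : i = j
  · subst hij
    simp only [Matrix.diagonal_apply_eq, Matrix.smul_apply, smul_eq_mul]
    rw [Finset.sum_eq_single (hA.eigenvalues i)]
    · simp
    · intro c _ hc
      simp [hc.symm]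
    · intro h
      exact absurd (by simp [spectrumFinset, hA]) h
  · simp [Matrix.diagonal_apply_ne _ hij]

theorem pvm_mul {d m : ℕ} {F : Fin m → Matrix (Fin d) (Fin d) ℂ} (hF : IsPVM F) (i j : Fin m) :
    F i * F j = if i = j then F i else 0 := by
  split_ifs with h
  · subst h; exact (hF.2.1 i).2
  · exact hF.2.2 i j h

theorem pinch_commute {d m : ℕ} {F : Fin m → Matrix (Fin d) (Fin d) ℂ} (hF : IsPVM F)
    (σ : Matrix (Fin d) (Fin d) ℂ) (j : Fin m) :
    F j * pinchPVM F σ = pinchPVM F σ * F j := by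
  have h1 : F j * pinchPVM F σ = F j * σ * F j := by
    rw [pinchPVM, Finset.mul_sum, Finset.sum_eq_single j]
    · rw [← mul_assoc, ← mul_assoc, (hF.2.1 j).2]
    · intro k _ hk
      rw [← mul_assoc, ← mul_assoc, hF.2.2 j k hk.symm, zero_mul, zero_mul]
    · simp
  have h2 : pinchPVM F σ * F j = F j * σ * F j := by
    rw [pinchPVM, Finset.sum_mul, Finset.sum_eq_single j]
    · rw [mul_assoc, (hF.2.1 j).2]
    · intro k _ hk
      rw [mul_assoc, hF.2.2 k j hk, mul_zero]
    · simp
  rw [h1, h2]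

theorem trace_pinch {d m : ℕ} {F : Fin m → Matrix (Fin d) (Fin d) ℂ} (hF : IsPVM F)
    (σ X : Matrix (Fin d) (Fin d) ℂ) (hX : ∀ j, F j * X = X * F j) :
    (pinchPVM F σ * X).trace = (σ * X).trace := by
  have h : ∀ j, (F j * σ * F j * X).trace = (σ * X * F j).trace := by
    intro j
    rw [mul_assoc, mul_assoc, Matrix.trace_mul_comm, hX j, mul_assoc, mul_assoc, (hF.2.1 j).2,
      mul_assoc]
  rw [pinchPVM, Finset.sum_mul, Matrix.trace_sum, Finset.sum_congr rfl fun j _ => h j,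
    ← Matrix.trace_sum, ← Finset.mul_sum, hF.1.2, mul_one]

/-- If a PVM `F` refines the spectral PVM of a positive definite state `ρ`,
then for every state `σ`: `D(σ‖ρ) = D(𝓔_F(σ)‖ρ) + D(σ‖𝓔_F(σ))`. -/
theorem statement3 (d m : ℕ) (σ ρ : Matrix (Fin d) (Fin d) ℂ)
    (hσ : IsState σ) (hρ : IsState ρ) (hρpd : ρ.PosDef)
    (F : Fin m → Matrix (Fin d) (Fin d) ℂ) (hF : IsPVM F)
    (hFρ : RefinesSpectral F ρ) :
    qRelEnt σ ρ = qRelEnt (pinchPVM F σ) ρ + qRelEnt σ (pinchPVM F σ) := by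
  have hP : (pinchPVM F σ).IsHermitian := by
    unfold pinchPVM Matrix.IsHermitian
    rw [Matrix.conjTranspose_sum]
    refine Finset.sum_congr rfl fun j _ => ?_
    rw [Matrix.conjTranspose_mul, Matrix.conjTranspose_mul, (hF.2.1 j).1.eq, hσ.1.1.eq, mul_assoc]
  have h1 := trace_pinch hF σ (matLog (pinchPVM F σ))
    fun j => commute_matCFC _ _ _ hP (pinch_commute hF σ j)
  have h2 := trace_pinch hF σ (matLog ρ) fun j => by
    rw [matLog, matCFC_eq_sum _ _ hρpd.1, Finset.mul_sum, Finset.sum_mul]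
    refine Finset.sum_congr rfl fun c hc => ?_
    obtain ⟨S, hS⟩ := hFρ c hc
    rw [hS, Matrix.mul_smul, Matrix.smul_mul, Finset.mul_sum, Finset.sum_mul]
    congr 1
    refine Finset.sum_congr rfl fun k _ => ?_
    rw [pvm_mul hF, pvm_mul hF]
    by_cases h : j = k
    · simp [h]
    · simp [h, Ne.symm h]
  simp only [qRelEnt, mul_sub, Matrix.trace_sub, h1, h2, Complex.sub_re]
  ring
end

section
/- Let E = (E_1, …, E_r) and F = (F_1, …, F_m) be PVMs on ℂ^d such that F refines E, and let σ be a state on ℂ^d with σ E_i = E_i σ for all i. Then D(σ ‖ 𝓔_F(σ)) ≤ log w(E), where w(E) := max_i rank(E_i) and 𝓔_F(σ) = Σ_j F_j σ F_j is the pinching of σ by F. -/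
open Matrix Filter ComplexOrder

/-- The real quadratic form of a matrix. -/
noncomputable def s4q {n : ℕ} (A : Matrix (Fin n) (Fin n) ℂ) (x : Fin n → ℂ) : ℝ :=
  (star x ⬝ᵥ (A *ᵥ x)).re

lemma s4_classical {n : ℕ} (lam tau : Fin n → ℝ) (hl : ∀ k, 0 ≤ lam k) (ht : ∀ l, 0 ≤ tau l)
    (hsum : ∑ k, lam k = 1) (M : Matrix (Fin n) (Fin n) ℂ)
    (hM : ∀ k, ∑ l, Complex.normSq (M k l) = 1) (w : ℝ) (hw : 0 < w)
    (h : ∀ y : Fin n → ℂ, ∑ k, lam k * Complex.normSq ((M *ᵥ y) k) ≤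
      w * ∑ l, tau l * Complex.normSq (y l)) :
    ∑ k, lam k * Real.log (lam k) -
      ∑ k, ∑ l, lam k * Complex.normSq (M k l) * Real.log (tau l) ≤ Real.log w := by
  have h0 : ∀ k l, 0 < lam k → tau l = 0 → Complex.normSq (M k l) = 0 := by
    intro k l hk hl0
    have h1 := h (Pi.single l 1)
    have h2 : ∑ l', tau l' * Complex.normSq ((Pi.single l 1 : Fin n → ℂ) l') = 0 := by
      apply Finset.sum_eq_zero
      intro l' _
      by_cases hll : l' = l
      · subst hll; simp [hl0]
      · simp [hll]
    rw [h2, mul_zero] at h1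
    have h3 := Finset.single_le_sum (f := fun k => lam k * Complex.normSq ((M *ᵥ Pi.single l 1) k))
      (fun k _ => mul_nonneg (hl k) (Complex.normSq_nonneg _)) (Finset.mem_univ k)
    simp only [Matrix.mulVec_single_one, Matrix.col_apply] at h3 h1
    have h4 := Complex.normSq_nonneg (M k l)
    nlinarith
  have hs : ∀ k, lam k * ∑ l, Complex.normSq (M k l) / tau l ≤ w := by
    intro k
    set s := ∑ l, Complex.normSq (M k l) / tau l with hsdef
    have hs0 : 0 ≤ s := Finset.sum_nonneg fun l _ => div_nonneg (Complex.normSq_nonneg _) (ht l)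
    have h1 := h (fun l => star (M k l) / (tau l : ℂ))
    have h2 : (M *ᵥ (fun l => star (M k l) / (tau l : ℂ))) k = (s : ℂ) := by
      simp only [Matrix.mulVec, dotProduct, hsdef]
      push_cast
      refine Finset.sum_congr rfl fun l _ => ?_
      rw [← mul_div_assoc, ← Complex.mul_conj]; rfl
    have h3 : ∑ l, tau l * Complex.normSq (star (M k l) / (tau l : ℂ)) = s := by
      refine Finset.sum_congr rfl fun l _ => ?_
      rw [Complex.normSq_div, Complex.normSq_ofReal]
      have : Complex.normSq (star (M k l)) = Complex.normSq (M k l) := Complex.normSq_conj _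
      rw [this]
      by_cases h0 : tau l = 0
      · simp [h0]
      · field_simp
    rw [h3] at h1
    have h4 := Finset.single_le_sum
      (f := fun k' => lam k' * Complex.normSq ((M *ᵥ (fun l => star (M k l) / (tau l : ℂ))) k'))
      (fun k _ => mul_nonneg (hl k) (Complex.normSq_nonneg _)) (Finset.mem_univ k)
    simp only [h2, Complex.normSq_ofReal] at h4
    have h5 := h4.trans h1
    rcases hs0.eq_or_lt with h6 | h6
    · rw [← h6]; simpa using hw.le
    · have : (lam k * s) * s ≤ w * s := by linarith
      exact le_of_mul_le_mul_right this h6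
  have key : ∀ k, lam k * Real.log (lam k) -
      ∑ l, lam k * Complex.normSq (M k l) * Real.log (tau l) ≤ lam k * Real.log w := by
    intro k
    rcases (hl k).eq_or_lt with hk | hk
    · simp [← hk]
    have h1 : ∀ l, Complex.normSq (M k l) * (Real.log (lam k) - Real.log (tau l) - Real.log w) ≤
        (lam k / w) * (Complex.normSq (M k l) / tau l) - Complex.normSq (M k l) := by
      intro l
      rcases (ht l).eq_or_lt with h2 | h2
      · rw [h0 k l hk h2.symm]; simp
      have h3 : Real.log (lam k) - Real.log (tau l) - Real.log w = Real.log (lam k / tau l / w) := by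
        rw [Real.log_div (by positivity) hw.ne', Real.log_div hk.ne' h2.ne']
      rw [h3]
      have h4 := Real.log_le_sub_one_of_pos (x := lam k / tau l / w) (by positivity)
      calc _ ≤ Complex.normSq (M k l) * (lam k / tau l / w - 1) :=
            mul_le_mul_of_nonneg_left h4 (Complex.normSq_nonneg _)
        _ = _ := by field_simp
    have h2 := Finset.sum_le_sum fun l (_ : l ∈ Finset.univ) => h1 l
    rw [Finset.sum_sub_distrib, ← Finset.mul_sum, hM] at h2
    have h3 : lam k / w * ∑ l, Complex.normSq (M k l) / tau l ≤ 1 := by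
      rw [div_mul_eq_mul_div, div_le_one hw]; exact hs k
    have h4 : ∑ l, Complex.normSq (M k l) * (Real.log (lam k) - Real.log (tau l) - Real.log w)
        = Real.log (lam k) - Real.log w - ∑ l, Complex.normSq (M k l) * Real.log (tau l) := by
      have : ∀ l, Complex.normSq (M k l) * (Real.log (lam k) - Real.log (tau l) - Real.log w)
        = Complex.normSq (M k l) * (Real.log (lam k) - Real.log w) -
          Complex.normSq (M k l) * Real.log (tau l) := fun l => by ring
      simp only [this, Finset.sum_sub_distrib, ← Finset.sum_mul, hM, one_mul]
    rw [h4] at h2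
    simp only [mul_assoc, ← Finset.mul_sum]
    nlinarith
  have := Finset.sum_le_sum fun k (_ : k ∈ Finset.univ) => key k
  rw [Finset.sum_sub_distrib, ← Finset.sum_mul, hsum, one_mul] at this
  exact this

lemma s4_spec {n : ℕ} (A : Matrix (Fin n) (Fin n) ℂ) (hA : A.IsHermitian) :
    A = (hA.eigenvectorUnitary : Matrix (Fin n) (Fin n) ℂ) *
      Matrix.diagonal (fun i => (hA.eigenvalues i : ℂ)) *
      star (hA.eigenvectorUnitary : Matrix (Fin n) (Fin n) ℂ) := by
  conv_lhs => rw [hA.spectral_theorem, Unitary.conjStarAlgAut_apply]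
  rfl

lemma s4_q_spec {n : ℕ} (U : Matrix (Fin n) (Fin n) ℂ) (f : Fin n → ℝ) (x : Fin n → ℂ) :
    s4q (U * Matrix.diagonal (fun i => (f i : ℂ)) * star U) x =
      ∑ k, f k * Complex.normSq ((star U *ᵥ x) k) := by
  have : star x ⬝ᵥ ((U * Matrix.diagonal (fun i => (f i : ℂ)) * star U) *ᵥ x)
      = star (star U *ᵥ x) ⬝ᵥ (Matrix.diagonal (fun i => (f i : ℂ)) *ᵥ (star U *ᵥ x)) := by
    rw [Matrix.star_mulVec, ← Matrix.dotProduct_mulVec]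
    simp [Matrix.mulVec_mulVec, Matrix.mul_assoc, Matrix.star_eq_conjTranspose]
  rw [s4q, this]
  simp only [dotProduct, Matrix.mulVec_diagonal, Pi.star_apply, Complex.re_sum]
  refine Finset.sum_congr rfl fun k _ => ?_
  simp [Complex.normSq_apply]
  ring

lemma s4_trace {n : ℕ} (U V : Matrix (Fin n) (Fin n) ℂ) (f g : Fin n → ℝ) :
    ((U * Matrix.diagonal (fun i => (f i : ℂ)) * star U) *
      (V * Matrix.diagonal (fun i => (g i : ℂ)) * star V)).trace.re =
      ∑ k, ∑ l, f k * Complex.normSq ((star U * V) k l) * g l := by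
  have : ((U * Matrix.diagonal (fun i => (f i : ℂ)) * star U) *
      (V * Matrix.diagonal (fun i => (g i : ℂ)) * star V)).trace =
      ((Matrix.diagonal (fun i => (f i : ℂ)) * (star U * V)) *
        (Matrix.diagonal (fun i => (g i : ℂ)) * star (star U * V))).trace := by
    rw [star_mul, star_star, Matrix.mul_assoc U, Matrix.mul_assoc U, Matrix.trace_mul_comm U]
    simp only [Matrix.mul_assoc]
  rw [this]
  simp only [Matrix.trace, Matrix.diag, Matrix.mul_apply (M := Matrix.diagonal _ * (star U * V)),
    Complex.re_sum, Matrix.diagonal_mul, Matrix.star_apply]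
  refine Finset.sum_congr rfl fun k _ => Finset.sum_congr rfl fun l _ => ?_
  simp [Complex.normSq_apply]
  ring

lemma s4_main {n : ℕ} (σ τ : Matrix (Fin n) (Fin n) ℂ) (hσ : σ.PosSemidef) (hτ : τ.PosSemidef)
    (htr : σ.trace = 1) (w : ℝ) (hw : 0 < w) (h : ∀ x, s4q σ x ≤ w * s4q τ x) :
    qRelEnt σ τ ≤ Real.log w := by
  have hσs := s4_spec σ hσ.1
  have hτs := s4_spec τ hτ.1
  have hσl : matLog σ = (hσ.1.eigenvectorUnitary : Matrix (Fin n) (Fin n) ℂ) *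
      Matrix.diagonal (fun i => (Real.log (hσ.1.eigenvalues i) : ℂ)) *
      star (hσ.1.eigenvectorUnitary : Matrix (Fin n) (Fin n) ℂ) := by
    rw [matLog, matCFC, dif_pos hσ.1]
  have hτl : matLog τ = (hτ.1.eigenvectorUnitary : Matrix (Fin n) (Fin n) ℂ) *
      Matrix.diagonal (fun i => (Real.log (hτ.1.eigenvalues i) : ℂ)) *
      star (hτ.1.eigenvectorUnitary : Matrix (Fin n) (Fin n) ℂ) := by
    rw [matLog, matCFC, dif_pos hτ.1]
  have hl : ∀ k, 0 ≤ hσ.1.eigenvalues k := hσ.eigenvalues_nonneg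
  have ht : ∀ k, 0 ≤ hτ.1.eigenvalues k := hτ.eigenvalues_nonneg
  have hsum : ∑ k, hσ.1.eigenvalues k = 1 := by
    have := hσ.1.trace_eq_sum_eigenvalues
    rw [htr] at this
    have h2 := congrArg Complex.re this
    simpa using h2.symm
  have hU : star (hσ.1.eigenvectorUnitary : Matrix (Fin n) (Fin n) ℂ) *
      (hσ.1.eigenvectorUnitary : Matrix (Fin n) (Fin n) ℂ) = 1 := by simp
  have hV : star (hτ.1.eigenvectorUnitary : Matrix (Fin n) (Fin n) ℂ) *
      (hτ.1.eigenvectorUnitary : Matrix (Fin n) (Fin n) ℂ) = 1 := by simp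
  have hV' : (hτ.1.eigenvectorUnitary : Matrix (Fin n) (Fin n) ℂ) *
      star (hτ.1.eigenvectorUnitary : Matrix (Fin n) (Fin n) ℂ) = 1 := by simp
  generalize (hσ.1.eigenvectorUnitary : Matrix (Fin n) (Fin n) ℂ) = U at *
  generalize (hτ.1.eigenvectorUnitary : Matrix (Fin n) (Fin n) ℂ) = V at *
  generalize hσ.1.eigenvalues = lam at *
  generalize hτ.1.eigenvalues = tau at *
  have h1 : (σ * matLog σ).trace.re = ∑ k, lam k * Real.log (lam k) := by
    rw [hσl]
    conv_lhs => rw [hσs]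
    rw [s4_trace, hU]
    refine Finset.sum_congr rfl fun k _ => ?_
    rw [Finset.sum_eq_single k]
    · simp
    · intro b _ hb; simp [Matrix.one_apply_ne hb.symm]
    · simp
  have h2 : (σ * matLog τ).trace.re =
      ∑ k, ∑ l, lam k * Complex.normSq ((star U * V) k l) * Real.log (tau l) := by
    rw [hτl]
    conv_lhs => rw [hσs]
    rw [s4_trace]
  rw [qRelEnt, Matrix.mul_sub, Matrix.trace_sub, Complex.sub_re, h1, h2]
  refine s4_classical lam tau hl ht hsum (star U * V) ?_ w hw ?_
  · intro k
    have h3 : (star U * V) * star (star U * V) = 1 := by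
      rw [star_mul, star_star, Matrix.mul_assoc, ← Matrix.mul_assoc V, hV', Matrix.one_mul, hU]
    have h4 := congrFun (congrFun h3 k) k
    rw [Matrix.mul_apply, Matrix.one_apply_eq] at h4
    have h5 := congrArg Complex.re h4
    rw [Complex.re_sum, Complex.one_re] at h5
    rw [← h5]
    refine Finset.sum_congr rfl fun l _ => ?_
    rw [Matrix.star_apply]
    simp [Complex.normSq_apply]
  · intro y
    have h3 := h (V *ᵥ y)
    rw [hσs, hτs, s4_q_spec, s4_q_spec, Matrix.mulVec_mulVec, Matrix.mulVec_mulVec, hV,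
      Matrix.one_mulVec] at h3
    exact h3

lemma s4_rank_trace {n : ℕ} (P : Matrix (Fin n) (Fin n) ℂ) (hP : P * P = P) :
    P.trace = (P.rank : ℂ) := by
  have h : IsIdempotentElem P.toLin' := by
    rw [IsIdempotentElem, Module.End.mul_eq_comp, ← Matrix.toLin'_mul, hP]
  have := (LinearMap.IsIdempotentElem.isProj_range _ h).trace
  rw [Matrix.trace_toLin'_eq] at this
  exact this

lemma s4_rank_zero {n : ℕ} (P : Matrix (Fin n) (Fin n) ℂ) (hP : P.rank = 0) : P = 0 := by
  rw [Matrix.rank, Submodule.finrank_eq_zero, LinearMap.range_eq_bot] at hP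
  have : Matrix.toLin' P = 0 := hP
  simpa using this

/-- Splitting of the quadratic form by a commuting PVM. -/
lemma s4_split {n r : ℕ} (E : Fin r → Matrix (Fin n) (Fin n) ℂ) (hE : IsPVM E)
    (A : Matrix (Fin n) (Fin n) ℂ) (hA : ∀ i, A * E i = E i * A) (x : Fin n → ℂ) :
    s4q A x = ∑ i, s4q A (E i *ᵥ x) := by
  have h1 : ∀ i, star (E i *ᵥ x) ⬝ᵥ (A *ᵥ (E i *ᵥ x)) = star x ⬝ᵥ ((A * E i) *ᵥ x) := by
    intro i
    rw [Matrix.star_mulVec, ← Matrix.dotProduct_mulVec, (hE.2.1 i).1.eq, Matrix.mulVec_mulVec,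
      Matrix.mulVec_mulVec, ← hA, Matrix.mul_assoc, (hE.2.1 i).2]
  simp only [s4q, h1, ← Complex.re_sum, ← dotProduct_sum, ← Matrix.sum_mulVec, ← Finset.mul_sum,
    hE.1.2, Matrix.mul_one]

lemma s4_q_sum_le {n m : ℕ} (σ : Matrix (Fin n) (Fin n) ℂ) (hσ : σ.PosSemidef)
    (S : Finset (Fin m)) (y : Fin m → Fin n → ℂ) :
    s4q σ (∑ j ∈ S, y j) ≤ S.card * ∑ j ∈ S, s4q σ (y j) := by
  have hs := s4_spec σ hσ.1
  have hl : ∀ k, 0 ≤ hσ.1.eigenvalues k := hσ.eigenvalues_nonneg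
  generalize (hσ.1.eigenvectorUnitary : Matrix (Fin n) (Fin n) ℂ) = U at *
  generalize hσ.1.eigenvalues = lam at *
  rw [hs]
  simp only [s4_q_spec]
  rw [Finset.sum_comm, Finset.mul_sum]
  refine Finset.sum_le_sum fun k _ => ?_
  rw [← Finset.mul_sum, mul_left_comm]
  refine mul_le_mul_of_nonneg_left ?_ (hl k)
  simp only [Matrix.mulVec_sum, Finset.sum_apply, Complex.normSq_eq_norm_sq]
  calc _ ≤ (∑ j ∈ S, ‖(star U *ᵥ y j) k‖) ^ 2 := by
        gcongr; exact norm_sum_le _ _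
    _ ≤ _ := sq_sum_le_card_mul_sum_sq

lemma s4_q_pinch {n m : ℕ} (F : Fin m → Matrix (Fin n) (Fin n) ℂ) (hF : IsPVM F)
    (σ : Matrix (Fin n) (Fin n) ℂ) (y : Fin n → ℂ) :
    s4q (pinchPVM F σ) y = ∑ j, s4q σ (F j *ᵥ y) := by
  simp only [s4q, pinchPVM, Matrix.sum_mulVec, dotProduct_sum, Complex.re_sum]
  refine Finset.sum_congr rfl fun j _ => ?_
  rw [Matrix.star_mulVec, ← Matrix.dotProduct_mulVec, (hF.2.1 j).1.eq, Matrix.mulVec_mulVec,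
      Matrix.mulVec_mulVec]

lemma s4_pinch_comm {n m : ℕ} (F : Fin m → Matrix (Fin n) (Fin n) ℂ) (hF : IsPVM F)
    (σ : Matrix (Fin n) (Fin n) ℂ) (j : Fin m) :
    pinchPVM F σ * F j = F j * pinchPVM F σ := by
  have h1 : pinchPVM F σ * F j = F j * σ * F j := by
    rw [pinchPVM, Finset.sum_mul, Finset.sum_eq_single j]
    · rw [Matrix.mul_assoc, (hF.2.1 j).2]
    · intro b _ hb; rw [Matrix.mul_assoc, hF.2.2 b j hb, Matrix.mul_zero]
    · simp
  have h2 : F j * pinchPVM F σ = F j * σ * F j := by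
    rw [pinchPVM, Finset.mul_sum, Finset.sum_eq_single j]
    · rw [← Matrix.mul_assoc, ← Matrix.mul_assoc, (hF.2.1 j).2]
    · intro b _ hb
      rw [← Matrix.mul_assoc, ← Matrix.mul_assoc, hF.2.2 j b hb.symm, Matrix.zero_mul,
        Matrix.zero_mul]
    · simp
  rw [h1, h2]

open Classical in
lemma s4_card {n m : ℕ} (F : Fin m → Matrix (Fin n) (Fin n) ℂ) (hF : IsPVM F)
    (P : Matrix (Fin n) (Fin n) ℂ) (hP : P * P = P) (S : Finset (Fin m))
    (hS : P = ∑ j ∈ S, F j) : (S.filter (fun j => F j ≠ 0)).card ≤ P.rank := by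
  have h1 : P.rank = ∑ j ∈ S, (F j).rank := by
    have h2 := s4_rank_trace P hP
    rw [hS, Matrix.trace_sum, Finset.sum_congr rfl fun j _ => s4_rank_trace (F j) (hF.2.1 j).2,
      ← hS] at h2
    exact_mod_cast h2.symm
  rw [h1, Finset.card_filter]
  refine Finset.sum_le_sum fun j _ => ?_
  split_ifs with h
  · rw [Nat.one_le_iff_ne_zero]
    intro h0
    exact h (s4_rank_zero _ h0)
  · exact Nat.zero_le _

lemma s4_q_nonneg {n : ℕ} (σ : Matrix (Fin n) (Fin n) ℂ) (hσ : σ.PosSemidef) (x : Fin n → ℂ) :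
    0 ≤ s4q σ x := hσ.re_dotProduct_nonneg x

/-- If a PVM `F` refines a PVM `E` and the state `σ` commutes with every
member of `E`, then `D(σ‖𝓔_F(σ)) ≤ log w(E)` with `w(E) = max_i rank(E_i)`. -/
theorem statement4 (d r m : ℕ)
    (E : Fin r → Matrix (Fin d) (Fin d) ℂ) (hE : IsPVM E)
    (F : Fin m → Matrix (Fin d) (Fin d) ℂ) (hF : IsPVM F)
    (hFE : Refines F E)
    (σ : Matrix (Fin d) (Fin d) ℂ) (hσ : IsState σ)
    (hσE : ∀ i, σ * E i = E i * σ) :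
    qRelEnt σ (pinchPVM F σ) ≤ Real.log ((Finset.univ.sup fun i => (E i).rank : ℕ) : ℝ) := by
  classical
  have hτ : (pinchPVM F σ).PosSemidef := by
    refine Matrix.posSemidef_sum _ fun j _ => ?_
    have := hσ.1.mul_mul_conjTranspose_same (F j)
    rwa [(hF.2.1 j).1.eq] at this
  set w : ℕ := Finset.univ.sup fun i => (E i).rank with hw
  have hineq : ∀ x, s4q σ x ≤ (w : ℝ) * s4q (pinchPVM F σ) x := by
    intro x
    have hcomm : ∀ i, pinchPVM F σ * E i = E i * pinchPVM F σ := by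
      intro i
      obtain ⟨S, hS⟩ := hFE i
      rw [hS, Finset.mul_sum, Finset.sum_mul]
      exact Finset.sum_congr rfl fun j _ => s4_pinch_comm F hF σ j
    rw [s4_split E hE σ hσE, s4_split E hE _ hcomm, Finset.mul_sum]
    refine Finset.sum_le_sum fun i _ => ?_
    obtain ⟨S, hS⟩ := hFE i
    have hy : E i *ᵥ x = ∑ j ∈ S.filter (fun j => F j ≠ 0), F j *ᵥ (E i *ᵥ x) := by
      rw [← Matrix.sum_mulVec, Finset.sum_filter_ne_zero, ← hS, Matrix.mulVec_mulVec,
        (hE.2.1 i).2]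
    rw [s4_q_pinch F hF]
    have hc : (S.filter (fun j => F j ≠ 0)).card ≤ w :=
      (s4_card F hF (E i) (hE.2.1 i).2 S hS).trans
        (Finset.le_sup (f := fun i => (E i).rank) (Finset.mem_univ i))
    calc s4q σ (E i *ᵥ x) = s4q σ (∑ j ∈ S.filter (fun j => F j ≠ 0), F j *ᵥ (E i *ᵥ x)) := by
          rw [← hy]
      _ ≤ _ := s4_q_sum_le σ hσ.1 _ _
      _ ≤ _ := by
        refine mul_le_mul (by exact_mod_cast hc) ?_
          (Finset.sum_nonneg fun j _ => s4_q_nonneg σ hσ.1 _) (Nat.cast_nonneg _)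
        exact Finset.sum_le_sum_of_subset_of_nonneg (Finset.subset_univ _)
          fun j _ _ => s4_q_nonneg σ hσ.1 _
  have hwpos : 0 < w := by
    rw [Nat.pos_iff_ne_zero]
    intro h0
    have hE0 : ∀ i, E i = 0 := by
      intro i
      have := Finset.le_sup (f := fun i => (E i).rank) (Finset.mem_univ i)
      rw [← hw, h0] at this
      have h1 : (E i).rank = 0 := Nat.le_zero.mp this
      exact s4_rank_zero _ h1
    have h1 : (1 : Matrix (Fin d) (Fin d) ℂ) = 0 := by
      rw [← hE.1.2]; simp [hE0]
    have h2 : σ = 0 := by rw [← Matrix.mul_one σ, h1, Matrix.mul_zero]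
    have h3 := hσ.2
    rw [h2] at h3
    simp at h3
  exact s4_main σ _ hσ.1 hτ hσ.2 w (by exact_mod_cast hwpos) hineq
end

section
/- Let σ and ρ be states on ℂ^d with ρ positive definite. There exists a POVM M on ℂ^d with D_M(σ ‖ ρ) = D(σ ‖ ρ) if and only if σρ = ρσ. -/
open Matrix Filter ComplexOrder

theorem aux_scalar_deriv {I : Type*} [Fintype I] (w s r : I → ℝ) (t : ℝ)
    (h : ∀ i, s i = 0 ∨ 0 < r i + t * s i) :
    HasDerivAt (fun t : ℝ => ∑ i, w i * (s i * Real.log (r i + t * s i)))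
      (∑ i, w i * (s i ^ 2 / (r i + t * s i))) t := by
  apply HasDerivAt.fun_sum
  intro i _
  apply HasDerivAt.const_mul
  rcases h i with h | h
  · simp only [h]; simpa using hasDerivAt_const t (0:ℝ)
  · have h1 : HasDerivAt (fun t : ℝ => r i + t * s i) (s i) t := by
      simpa using ((hasDerivAt_id t).mul_const (s i)).const_add (r i)
    have := (h1.log h.ne').const_mul (s i)
    convert this using 1
    ring

theorem aux_scalar_lim {I : Type*} [Fintype I] (w s r : I → ℝ)
    (hs : ∀ i, 0 ≤ s i) (hr : ∀ i, 0 ≤ r i) (h1 : ∑ i, w i * s i = 1) :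
    Tendsto (fun t : ℝ => ∑ i, w i * (s i * Real.log (r i + t * s i)) - Real.log t) atTop
      (nhds (∑ i, w i * (s i * Real.log (s i)))) := by
  have key : Tendsto (fun t : ℝ => ∑ i, w i * (s i * Real.log (r i / t + s i))) atTop
      (nhds (∑ i, w i * (s i * Real.log (s i)))) := by
    apply tendsto_finsetSum
    intro i _
    apply Tendsto.const_mul
    rcases (hs i).eq_or_lt with h | h
    · simp [← h]
    · apply Tendsto.const_mul
      have h2 : Tendsto (fun t : ℝ => r i / t + s i) atTop (nhds (0 + s i)) :=
        (tendsto_const_nhds.div_atTop tendsto_id).add_const _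
      rw [zero_add] at h2
      exact h2.log h.ne'
  refine key.congr' ?_
  filter_upwards [eventually_gt_atTop 0] with t ht
  have : Real.log t = ∑ i, w i * (s i * Real.log t) := by
    simp_rw [← mul_assoc, ← Finset.sum_mul, h1, one_mul]
  rw [this, ← Finset.sum_sub_distrib]
  apply Finset.sum_congr rfl
  intro i _
  rcases (hs i).eq_or_lt with h | h
  · simp [← h]
  · have e : r i / t + s i = (r i + t * s i) / t := by field_simp
    have : 0 < r i + t * s i := by have := hr i; positivity
    rw [e, Real.log_div this.ne' ht.ne']
    ring

theorem aux_scalar {I J : Type*} [Fintype I] [Fintype J] (w s r : I → ℝ) (p q : J → ℝ)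
    (hs : ∀ i, 0 ≤ s i) (hr : ∀ i, 0 < r i) (hp : ∀ j, 0 ≤ p j) (hq : ∀ j, 0 ≤ q j)
    (hpq : ∀ j, p j = 0 ∨ 0 < q j)
    (h1 : ∑ i, w i * s i = 1) (h2 : ∑ j, p j = 1)
    (hG : ∀ t, 0 ≤ t → ∑ j, p j ^ 2 / (q j + t * p j) ≤ ∑ i, w i * (s i ^ 2 / (r i + t * s i)))
    (heq : ∑ j, p j * Real.log (p j / q j) =
      ∑ i, w i * (s i * (Real.log (s i) - Real.log (r i)))) :
    ∑ j, p j ^ 2 / q j = ∑ i, w i * (s i ^ 2 / r i) := by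
  set F : ℝ → ℝ := fun t => ∑ i, w i * (s i * Real.log (r i + t * s i)) -
    ∑ j, 1 * (p j * Real.log (q j + t * p j)) with hF
  have hd : ∀ t, 0 ≤ t → HasDerivAt F (∑ i, w i * (s i ^ 2 / (r i + t * s i)) -
      ∑ j, 1 * (p j ^ 2 / (q j + t * p j))) t := by
    intro t ht
    apply HasDerivAt.sub
    · apply aux_scalar_deriv
      intro i; right
      have := hs i; have := hr i; positivity
    · apply aux_scalar_deriv (fun _ => 1)
      intro j
      rcases hpq j with h | h
      · exact Or.inl h
      · right; have := hp j; positivity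
  have hmono : MonotoneOn F (Set.Ici 0) := by
    apply monotoneOn_of_deriv_nonneg (convex_Ici 0)
    · intro t ht; exact (hd t ht).continuousAt.continuousWithinAt
    · intro t ht
      rw [interior_Ici] at ht
      exact (hd t (le_of_lt ht)).differentiableAt.differentiableWithinAt
    · intro t ht
      rw [interior_Ici] at ht
      rw [(hd t (le_of_lt ht)).deriv]
      simpa using hG t (le_of_lt ht)
  have hlim : Tendsto F atTop (nhds (∑ i, w i * (s i * Real.log (s i)) -
      ∑ j, 1 * (p j * Real.log (p j)))) := by
    have := (aux_scalar_lim w s r hs (fun i => (hr i).le) h1).sub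
      (aux_scalar_lim (fun _ => 1) p q hp hq (by simpa using h2))
    refine this.congr ?_
    intro t; simp only [hF]; ring
  have hF0 : F 0 = ∑ i, w i * (s i * Real.log (s i)) - ∑ j, 1 * (p j * Real.log (p j)) := by
    simp only [hF, zero_mul, add_zero, one_mul]
    have e : ∑ j, p j * Real.log (p j / q j) =
        ∑ j, p j * Real.log (p j) - ∑ j, p j * Real.log (q j) := by
      rw [← Finset.sum_sub_distrib]
      apply Finset.sum_congr rfl
      intro j _
      rcases (hp j).eq_or_lt with h | h
      · simp [← h]
      · have : 0 < q j := (hpq j).resolve_left h.ne'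
        rw [Real.log_div h.ne' this.ne']; ring
    rw [e] at heq
    simp only [mul_sub, Finset.sum_sub_distrib] at heq
    linarith
  have hconst : ∀ t ∈ Set.Ici (0:ℝ), F t = F 0 := by
    intro t ht
    apply le_antisymm
    · rw [hF0]
      apply ge_of_tendsto hlim
      filter_upwards [eventually_ge_atTop t] with u hu
      exact hmono ht (le_trans ht hu) hu
    · exact hmono (Set.mem_Ici.2 le_rfl) ht ht
  have hd0 := (hd 0 le_rfl).hasDerivWithinAt (s := Set.Ici 0)
  have hd1 : HasDerivWithinAt F 0 (Set.Ici 0) 0 :=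
    (hasDerivWithinAt_const (0:ℝ) (Set.Ici 0) (F 0)).congr hconst rfl
  have := (uniqueDiffWithinAt_Ici (0:ℝ)).eq_deriv _ hd0 hd1
  simp at this
  linarith

section Mats
variable {ι : Type*} [Fintype ι] [DecidableEq ι]

theorem aux_normSq (z : ℂ) : (star z * z).re = ‖z‖ ^ 2 := by
  rw [← Complex.normSq_eq_norm_sq, Complex.normSq_apply]; simp

/-- trace of product of diagonalized matrices -/
theorem aux_tr (U V : Matrix ι ι ℂ) (f g : ι → ℝ) :
    ((U * diagonal (fun i => (f i : ℂ)) * star U) *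
      (V * diagonal (fun i => (g i : ℂ)) * star V)).trace.re =
    ∑ x : ι × ι, ‖(star V * U) x.2 x.1‖ ^ 2 * (f x.1 * g x.2) := by
  set W := star V * U with hW
  have hW' : star W = star U * V := by simp [hW, star_mul]
  have : ((U * diagonal (fun i => (f i : ℂ)) * star U) *
      (V * diagonal (fun i => (g i : ℂ)) * star V)).trace =
      (diagonal (fun i => (f i : ℂ)) * (star W * (diagonal (fun i => (g i : ℂ)) * W))).trace := by
    rw [hW', hW]
    simp only [mul_assoc]
    rw [trace_mul_comm]
    simp only [mul_assoc]
  rw [this, Fintype.sum_prod_type]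
  simp only [trace, diag_apply, diagonal_mul, mul_apply (M := star W), star_apply, Complex.re_sum]
  apply Finset.sum_congr rfl
  intro a _
  rw [Finset.mul_sum, Complex.re_sum]
  apply Finset.sum_congr rfl
  intro b _
  rw [← aux_normSq]
  have : (f a : ℂ) * (star (W b a) * ((g b : ℂ) * W b a)) =
    ((f a * g b : ℝ) : ℂ) * (star (W b a) * W b a) := by push_cast; ring
  rw [this, Complex.re_ofReal_mul]; ring

theorem aux_psd_tr (A B : Matrix ι ι ℂ) (hA : A.PosSemidef) (hB : B.PosSemidef) :
    0 ≤ (A * B).trace.re := by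
  have hs := hA.1.spectral_theorem
  rw [Unitary.conjStarAlgAut_apply] at hs
  set U : Matrix ι ι ℂ := (hA.1.eigenvectorUnitary : Matrix ι ι ℂ)
  have hs2 := hB.1.spectral_theorem
  rw [Unitary.conjStarAlgAut_apply] at hs2
  set V : Matrix ι ι ℂ := (hB.1.eigenvectorUnitary : Matrix ι ι ℂ)
  rw [hs, hs2]
  have := aux_tr U V hA.1.eigenvalues hB.1.eigenvalues
  refine le_of_le_of_eq ?_ this.symm
  apply Finset.sum_nonneg
  intro x _
  have := hA.eigenvalues_nonneg x.1
  have := hB.eigenvalues_nonneg x.2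
  positivity

theorem aux_spec (A : Matrix ι ι ℂ) (hA : A.IsHermitian) :
    A = (hA.eigenvectorUnitary : Matrix ι ι ℂ) *
      diagonal (fun i => (hA.eigenvalues i : ℂ)) *
      star (hA.eigenvectorUnitary : Matrix ι ι ℂ) := by
  have hs := hA.spectral_theorem
  rw [Unitary.conjStarAlgAut_apply] at hs
  exact hs

theorem aux_pd_tr (A B : Matrix ι ι ℂ) (hA : A.PosSemidef) (hB : B.PosDef)
    (h : (A * B).trace.re = 0) : A = 0 := by
  rw [aux_spec A hA.1, aux_spec B hB.1, aux_tr] at h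
  set U : Matrix ι ι ℂ := (hA.1.eigenvectorUnitary : Matrix ι ι ℂ) with hU
  set V : Matrix ι ι ℂ := (hB.1.eigenvectorUnitary : Matrix ι ι ℂ) with hV
  have hVV : V * star V = 1 := Unitary.mul_star_self_of_mem hB.1.eigenvectorUnitary.2
  rw [Finset.sum_eq_zero_iff_of_nonneg] at h
  · have h3 : (star V * U) * diagonal (fun i => (hA.1.eigenvalues i : ℂ)) = 0 := by
      ext b a
      have := h (a, b) (Finset.mem_univ _)
      simp only [mul_eq_zero, pow_eq_zero_iff, ne_eq, OfNat.ofNat_ne_zero, not_false_eq_true,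
        norm_eq_zero, (hB.eigenvalues_pos b).ne', or_false] at this
      rw [mul_diagonal]
      rcases this with h | h <;> simp [h]
    rw [aux_spec A hA.1, ← hU]
    have h4 : U * diagonal (fun i => (hA.1.eigenvalues i : ℂ)) = 0 := by
      have := congrArg (fun Z => V * Z) h3
      simp only [← mul_assoc, hVV, one_mul, mul_zero] at this
      exact this
    rw [h4, zero_mul]
  · intro x _
    have := hA.eigenvalues_nonneg x.1
    have := (hB.eigenvalues_pos x.2).le
    positivity

theorem aux_kadison {J : Type*} [Fintype J] (M : J → Matrix ι ι ℂ) (hM : IsPOVM M) (x : J → ℝ)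
    (τ : Matrix ι ι ℂ) (hτ : τ.PosSemidef) :
    (τ * ((∑ j, (x j : ℂ) • M j) * (∑ j, (x j : ℂ) • M j))).trace.re ≤
      ∑ j, x j ^ 2 * probOf (M j) τ := by
  set X := ∑ j, (x j : ℂ) • M j with hX
  have hXH : Xᴴ = X := by
    rw [hX, conjTranspose_sum]
    apply Finset.sum_congr rfl
    intro j _
    rw [conjTranspose_smul, (hM.1 j).1.eq]; simp
  have key : ∑ j, ((x j : ℂ) • 1 - X) * M j * ((x j : ℂ) • 1 - X) =
      ∑ j, ((x j : ℂ) ^ 2) • M j - X * X := by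
    have e : ∀ j, ((x j : ℂ) • 1 - X) * M j * ((x j : ℂ) • 1 - X) =
        ((x j : ℂ) ^ 2) • M j - ((x j : ℂ) • M j) * X - X * ((x j : ℂ) • M j) + X * M j * X := by
      intro j
      simp only [sub_mul, mul_sub, smul_mul_assoc, mul_smul_comm, one_mul, mul_one, pow_two, mul_smul,
        smul_sub]
      abel
    simp_rw [e]
    rw [Finset.sum_add_distrib, Finset.sum_sub_distrib, Finset.sum_sub_distrib, ← Finset.sum_mul,
      ← Finset.mul_sum, ← Finset.sum_mul, ← Finset.mul_sum, hM.2, ← hX]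
    simp
  have hpsd : (∑ j, ((x j : ℂ) ^ 2) • M j - X * X).PosSemidef := by
    rw [← key]
    apply posSemidef_sum
    intro j _
    have := (hM.1 j).conjTranspose_mul_mul_same ((x j : ℂ) • 1 - X)
    simpa [conjTranspose_sub, hXH] using this
  have := aux_psd_tr τ _ hτ hpsd
  rw [mul_sub, trace_sub, Complex.sub_re, Finset.mul_sum, trace_sum, Complex.re_sum] at this
  have e : ∀ j, (τ * ((x j : ℂ) ^ 2) • M j).trace.re = x j ^ 2 * probOf (M j) τ := by
    intro j
    rw [mul_smul_comm, trace_smul, smul_eq_mul, trace_mul_comm, ← Complex.ofReal_pow,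
      Complex.re_ofReal_mul]; rfl
  simp_rw [e] at this
  linarith

theorem aux_pointwise (r s : ℝ) (hr : 0 < r) (c x : ℂ) :
    ‖c‖ ^ 2 * (s ^ 2 / r) - 2 * (s * (star c * x).re) + r * ‖x‖ ^ 2 = ‖r * x - s * c‖ ^ 2 / r := by
  rw [eq_div_iff hr.ne']
  simp only [← Complex.normSq_eq_norm_sq, Complex.normSq_apply]
  simp
  field_simp
  ring

/-- the quadratic expansion -/
theorem aux_quad (U V : Matrix ι ι ℂ) (hU : U * star U = 1) (hV : V * star V = 1) (s r : ι → ℝ)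
    (hs : ∀ i, 0 ≤ s i) (hr : ∀ i, 0 < r i) (σ ρ X : Matrix ι ι ℂ) (hX : star X = X)
    (hσ : σ = U * diagonal (fun i => (s i : ℂ)) * star U)
    (hρ : ρ = V * diagonal (fun i => (r i : ℂ)) * star V) (t : ℝ) (ht : 0 ≤ t) :
    ∑ x : ι × ι, ‖(star V * U) x.2 x.1‖ ^ 2 * (s x.1 ^ 2 / (r x.2 + t * s x.1))
      - 2 * (σ * X).trace.re + ((ρ * (X * X)).trace.re + t * (σ * (X * X)).trace.re) =
    ∑ x : ι × ι, ‖((r x.2 + t * s x.1 : ℝ) : ℂ) * (star V * X * U) x.2 x.1 -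
      (s x.1 : ℂ) * (star V * U) x.2 x.1‖ ^ 2 / (r x.2 + t * s x.1) := by
  set W := star V * U with hW
  set Y := star V * X * U with hY
  have hU' : star U * U = 1 := mul_eq_one_comm.1 hU
  have e1 : (σ * X).trace.re = ∑ x : ι × ι, s x.1 * (star (W x.2 x.1) * Y x.2 x.1).re := by
    have h1 : (σ * X).trace = (diagonal (fun i => (s i : ℂ)) * (star W * Y)).trace := by
      have : star W * Y = star U * X * U := by
        rw [hW, hY, star_mul, star_star]
        calc star U * V * (star V * X * U) = star U * (V * star V) * X * U := by
              simp only [mul_assoc]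
          _ = _ := by rw [hV, mul_one]
      rw [this, hσ]
      simp only [mul_assoc]
      rw [trace_mul_comm]
      simp only [mul_assoc]
    rw [h1, Fintype.sum_prod_type]
    simp only [trace, diag_apply, diagonal_mul]
    simp only [mul_apply, star_apply, Complex.re_sum,
      Complex.re_ofReal_mul, Finset.mul_sum]
  have e2 : (σ * (X * X)).trace.re = ∑ x : ι × ι, s x.1 * ‖Y x.2 x.1‖ ^ 2 := by
    have h1 : (σ * (X * X)).trace = (diagonal (fun i => (s i : ℂ)) * (star Y * Y)).trace := by
      have : star Y * Y = star U * (X * X) * U := by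
        rw [hY, star_mul, star_mul, star_star, hX]
        calc star U * (X * V) * (star V * X * U) = star U * (X * (V * star V) * X) * U := by
              simp only [mul_assoc]
          _ = _ := by rw [hV, mul_one]
      rw [this, hσ]
      simp only [mul_assoc]
      rw [trace_mul_comm]
      simp only [mul_assoc]
    rw [h1, Fintype.sum_prod_type]
    simp only [trace, diag_apply, diagonal_mul]
    simp only [mul_apply, star_apply, Complex.re_sum,
      Complex.re_ofReal_mul, Finset.mul_sum, aux_normSq]
  have e3 : (ρ * (X * X)).trace.re = ∑ x : ι × ι, r x.2 * ‖Y x.2 x.1‖ ^ 2 := by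
    have h1 : (ρ * (X * X)).trace = (diagonal (fun i => (r i : ℂ)) * (Y * star Y)).trace := by
      have : Y * star Y = star V * (X * X) * V := by
        rw [hY, star_mul, star_mul, star_star, hX]
        calc star V * X * U * (star U * (X * V)) = star V * (X * (U * star U) * X) * V := by
              simp only [mul_assoc]
          _ = _ := by rw [hU, mul_one]
      rw [this, hρ]
      simp only [mul_assoc]
      rw [trace_mul_comm]
      simp only [mul_assoc]
    rw [h1, Fintype.sum_prod_type_right]
    simp only [trace, diag_apply, diagonal_mul]
    simp only [mul_apply, star_apply, Complex.re_sum,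
      Complex.re_ofReal_mul, Finset.mul_sum]
    apply Finset.sum_congr rfl; intro b _
    apply Finset.sum_congr rfl; intro a _
    rw [mul_comm (Y b a), aux_normSq]
  rw [e1, e2, e3, Finset.mul_sum, Finset.mul_sum, ← Finset.sum_sub_distrib,
    ← Finset.sum_add_distrib, ← Finset.sum_add_distrib]
  apply Finset.sum_congr rfl
  intro x _
  have hpos : 0 < r x.2 + t * s x.1 := by have := hs x.1; have := hr x.2; positivity
  rw [← aux_pointwise _ _ hpos]
  ring

theorem aux_tr_mul_log (A : Matrix ι ι ℂ) (hA : A.IsHermitian) (f g : ℝ → ℝ) :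
    matCFC f A * matCFC g A = matCFC (fun x => f x * g x) A := by
  simp only [matCFC, dif_pos hA]
  set U : Matrix ι ι ℂ := (hA.eigenvectorUnitary : Matrix ι ι ℂ) with hU
  have hUU : star U * U = 1 := Unitary.star_mul_self_of_mem hA.eigenvectorUnitary.2
  calc _ = U * (diagonal (fun i => (f (hA.eigenvalues i) : ℂ)) * (star U * U) *
        diagonal (fun i => (g (hA.eigenvalues i) : ℂ))) * star U := by simp only [mul_assoc]
    _ = _ := by rw [hUU, mul_one, diagonal_mul_diagonal]; simp

theorem aux_cfc_id (A : Matrix ι ι ℂ) (hA : A.IsHermitian) : matCFC (fun x => x) A = A := by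
  simp only [matCFC, dif_pos hA]
  exact (aux_spec A hA).symm

theorem aux_forward {J : Type*} [Fintype J] (σ ρ : Matrix ι ι ℂ) (hσ : IsState σ)
    (hρpd : ρ.PosDef) (M : J → Matrix ι ι ℂ) (hM : IsPOVM M)
    (h : Dm M σ ρ = qRelEnt σ ρ) : σ * ρ = ρ * σ := by
  set U : Matrix ι ι ℂ := (hσ.1.1.eigenvectorUnitary : Matrix ι ι ℂ) with hU
  set V : Matrix ι ι ℂ := (hρpd.1.eigenvectorUnitary : Matrix ι ι ℂ) with hV
  set s := hσ.1.1.eigenvalues with hs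
  set r := hρpd.1.eigenvalues with hr
  have hUU : U * star U = 1 := Unitary.mul_star_self_of_mem hσ.1.1.eigenvectorUnitary.2
  have hVV : V * star V = 1 := Unitary.mul_star_self_of_mem hρpd.1.eigenvectorUnitary.2
  have hUU' : star U * U = 1 := mul_eq_one_comm.1 hUU
  have hσe : σ = U * diagonal (fun i => (s i : ℂ)) * star U := aux_spec σ hσ.1.1
  have hρe : ρ = V * diagonal (fun i => (r i : ℂ)) * star V := aux_spec ρ hρpd.1
  have hs0 : ∀ i, 0 ≤ s i := hσ.1.eigenvalues_nonneg
  have hr0 : ∀ i, 0 < r i := hρpd.eigenvalues_pos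
  set p : J → ℝ := fun j => probOf (M j) σ with hp
  set q : J → ℝ := fun j => probOf (M j) ρ with hq
  have hp0 : ∀ j, 0 ≤ p j := fun j => aux_psd_tr _ _ (hM.1 j) hσ.1
  have hq0 : ∀ j, 0 ≤ q j := fun j => aux_psd_tr _ _ (hM.1 j) hρpd.posSemidef
  have hpq : ∀ j, p j = 0 ∨ 0 < q j := by
    intro j
    rcases (hq0 j).eq_or_lt with h | h
    · left
      have := aux_pd_tr (M j) ρ (hM.1 j) hρpd h.symm
      simp [hp, probOf, this]
    · exact Or.inr h
  have hp1 : ∑ j, p j = 1 := by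
    simp only [hp, probOf]
    rw [← Complex.re_sum, ← trace_sum, ← Finset.sum_mul, hM.2, one_mul, hσ.2]; simp
  have hone : (1 : Matrix ι ι ℂ) = V * diagonal (fun _ => ((1 : ℝ) : ℂ)) * star V := by
    simp [hVV]
  have hw1 : ∑ x : ι × ι, ‖(star V * U) x.2 x.1‖ ^ 2 * s x.1 = 1 := by
    have := aux_tr U V s (fun _ => 1)
    rw [← hone, ← hσe, mul_one, hσ.2] at this
    simpa using this.symm
  set X : (J → ℝ) → Matrix ι ι ℂ := fun x => ∑ j, (x j : ℂ) • M j with hX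
  have hXH : ∀ x, star (X x) = X x := by
    intro x
    rw [star_eq_conjTranspose]
    simp only [hX]
    rw [conjTranspose_sum]
    apply Finset.sum_congr rfl
    intro j _
    rw [conjTranspose_smul, (hM.1 j).1.eq]; simp
  have hXσ : ∀ x, (σ * X x).trace.re = ∑ j, x j * p j := by
    intro x
    simp only [hX]
    rw [Finset.mul_sum, trace_sum, Complex.re_sum]
    apply Finset.sum_congr rfl
    intro j _
    rw [mul_smul_comm, trace_smul, smul_eq_mul, trace_mul_comm, Complex.re_ofReal_mul]; rfl
  -- upper bound on the quadratic form
  have hub : ∀ t, 0 ≤ t → -2 * (σ * X (fun j => p j / (q j + t * p j))).trace.re +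
      ((ρ * (X (fun j => p j / (q j + t * p j)) * X (fun j => p j / (q j + t * p j)))).trace.re +
      t * (σ * (X (fun j => p j / (q j + t * p j)) * X (fun j => p j / (q j + t * p j)))).trace.re)
      ≤ - ∑ j, p j ^ 2 / (q j + t * p j) := by
    intro t ht
    have k1 := aux_kadison M hM (fun j => p j / (q j + t * p j)) ρ hρpd.posSemidef
    have k2 := aux_kadison M hM (fun j => p j / (q j + t * p j)) σ hσ.1
    have k3 := mul_le_mul_of_nonneg_left k2 ht
    have k4 := hXσ (fun j => p j / (q j + t * p j))
    have : ∑ j, (p j / (q j + t * p j)) ^ 2 * probOf (M j) ρ +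
        t * ∑ j, (p j / (q j + t * p j)) ^ 2 * probOf (M j) σ = ∑ j, p j ^ 2 / (q j + t * p j) := by
      rw [Finset.mul_sum, ← Finset.sum_add_distrib]
      apply Finset.sum_congr rfl
      intro j _
      change (p j / (q j + t * p j)) ^ 2 * q j + t * ((p j / (q j + t * p j)) ^ 2 * p j) = _
      by_cases h0 : q j + t * p j = 0
      · simp [h0]
      · field_simp
    have h5 : ∑ j, (p j / (q j + t * p j)) * p j = ∑ j, p j ^ 2 / (q j + t * p j) := by
      apply Finset.sum_congr rfl
      intro j _
      ring
    rw [h5] at k4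
    rw [k4]
    change (ρ * (X (fun j => p j / (q j + t * p j)) * X (fun j => p j / (q j + t * p j)))).trace.re ≤ _ at k1
    change t * (σ * (X (fun j => p j / (q j + t * p j)) * X (fun j => p j / (q j + t * p j)))).trace.re ≤ _ at k3
    linarith
  have hQ := fun t ht x => aux_quad U V hUU hVV s r hs0 hr0 σ ρ (X x) (hXH x) hσe hρe t ht
  have hG : ∀ t, 0 ≤ t → ∑ j, p j ^ 2 / (q j + t * p j) ≤
      ∑ x : ι × ι, ‖(star V * U) x.2 x.1‖ ^ 2 * (s x.1 ^ 2 / (r x.2 + t * s x.1)) := by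
    intro t ht
    have h1 := hQ t ht (fun j => p j / (q j + t * p j))
    have h2 := hub t ht
    have h3 : 0 ≤ ∑ x : ι × ι, ‖((r x.2 + t * s x.1 : ℝ) : ℂ) *
      (star V * X (fun j => p j / (q j + t * p j)) * U) x.2 x.1 -
      (s x.1 : ℂ) * (star V * U) x.2 x.1‖ ^ 2 / (r x.2 + t * s x.1) := by
      apply Finset.sum_nonneg
      intro x _
      have := hs0 x.1; have := hr0 x.2; positivity
    linarith
  have hent : qRelEnt σ ρ = ∑ x : ι × ι, ‖(star V * U) x.2 x.1‖ ^ 2 *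
      (s x.1 * (Real.log (s x.1) - Real.log (r x.2))) := by
    unfold qRelEnt matLog
    rw [mul_sub, trace_sub, Complex.sub_re]
    have h1 : (σ * matCFC Real.log σ) = U * diagonal (fun i => ((s i * Real.log (s i) : ℝ) : ℂ)) *
        star U := by
      have := aux_tr_mul_log σ hσ.1.1 (fun x => x) Real.log
      rw [aux_cfc_id σ hσ.1.1] at this
      rw [this]
      simp only [matCFC, dif_pos hσ.1.1]; rfl
    have h2 : matCFC Real.log ρ = V * diagonal (fun i => ((Real.log (r i) : ℝ) : ℂ)) *
        star V := by
      simp only [matCFC, dif_pos hρpd.1]; rfl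
    rw [h1, h2]
    conv_lhs => 
      congr
      · rw [← mul_one (U * _ * star U), hone, aux_tr]
      · rw [hσe, aux_tr]
    rw [← Finset.sum_sub_distrib]
    apply Finset.sum_congr rfl
    intro x _
    ring
  have hfin := aux_scalar (fun x : ι × ι => ‖(star V * U) x.2 x.1‖ ^ 2) (fun x => s x.1)
    (fun x => r x.2) p q (fun x => hs0 x.1) (fun x => hr0 x.2) hp0 hq0 hpq hw1 hp1 hG
    (by rw [← hent, ← h]; rfl)
  have h1 := hQ 0 le_rfl (fun j => p j / (q j + 0 * p j))
  have h2 := hub 0 le_rfl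
  simp only [zero_mul, add_zero] at h1 h2
  set X0 := X (fun j => p j / q j) with hX0
  have h3 : ∑ x : ι × ι, ‖((r x.2 : ℝ) : ℂ) * (star V * X0 * U) x.2 x.1 -
      (s x.1 : ℂ) * (star V * U) x.2 x.1‖ ^ 2 / r x.2 ≤ 0 := by
    linarith
  have hnn : ∀ x ∈ (Finset.univ : Finset (ι × ι)), 0 ≤ ‖((r x.2 : ℝ) : ℂ) * (star V * X0 * U) x.2 x.1 -
      (s x.1 : ℂ) * (star V * U) x.2 x.1‖ ^ 2 / r x.2 := by
    intro x _
    have := (hr0 x.2).le; positivity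
  have h4 := (Finset.sum_eq_zero_iff_of_nonneg hnn).1 (le_antisymm h3 (Finset.sum_nonneg hnn))
  have h5 : diagonal (fun i => (r i : ℂ)) * (star V * X0 * U) =
      (star V * U) * diagonal (fun i => (s i : ℂ)) := by
    ext b a
    have := h4 (a, b) (Finset.mem_univ _)
    simp only [div_eq_zero_iff, (hr0 b).ne', or_false, pow_eq_zero_iff, ne_eq,
      OfNat.ofNat_ne_zero, not_false_eq_true, norm_eq_zero, sub_eq_zero] at this
    rw [diagonal_mul, mul_diagonal, this, mul_comm]
  have h6 : ρ * X0 = σ := by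
    have := congrArg (fun Z => V * Z * star U) h5
    calc ρ * X0 = V * (diagonal (fun i => (r i : ℂ)) * (star V * X0 * U)) * star U := by
          rw [hρe]
          simp only [mul_assoc, hUU, mul_one]
      _ = V * (star V * U * diagonal (fun i => (s i : ℂ))) * star U := this
      _ = (V * star V) * (U * diagonal (fun i => (s i : ℂ)) * star U) := by simp only [mul_assoc]
      _ = σ := by rw [hVV, one_mul, ← hσe]
  have h7 : X0 * ρ = σ := by
    have := congrArg star h6
    rw [star_mul, hXH, star_eq_conjTranspose, hρpd.1.eq, star_eq_conjTranspose, hσ.1.1.eq] at this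
    exact this
  calc σ * ρ = ρ * X0 * ρ := by rw [h6]
    _ = ρ * σ := by rw [mul_assoc, h7]

theorem aux_cfc_comm (A B : Matrix ι ι ℂ) (hA : A.IsHermitian) (f : ℝ → ℝ) (h : A * B = B * A) :
    matCFC f A * B = B * matCFC f A := by
  simp only [matCFC, dif_pos hA]
  have hAe := aux_spec A hA
  set U : Matrix ι ι ℂ := (hA.eigenvectorUnitary : Matrix ι ι ℂ) with hU
  have hUU : U * star U = 1 := Unitary.mul_star_self_of_mem hA.eigenvectorUnitary.2
  have hUU' : star U * U = 1 := mul_eq_one_comm.1 hUU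
  have h1 : diagonal (fun i => (hA.eigenvalues i : ℂ)) * (star U * B * U) =
      (star U * B * U) * diagonal (fun i => (hA.eigenvalues i : ℂ)) := by
    calc _ = star U * (U * diagonal (fun i => (hA.eigenvalues i : ℂ)) * star U * B) * U := by
          simp only [← mul_assoc, hUU', one_mul]
      _ = star U * (B * (U * diagonal (fun i => (hA.eigenvalues i : ℂ)) * star U)) * U := by
          rw [← hAe, h]
      _ = _ := by simp only [mul_assoc, hUU', mul_one]
  have h2 : diagonal (fun i => (f (hA.eigenvalues i) : ℂ)) * (star U * B * U) =
      (star U * B * U) * diagonal (fun i => (f (hA.eigenvalues i) : ℂ)) := by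
    ext a b
    have := congrFun (congrFun h1 a) b
    rw [diagonal_mul, mul_diagonal] at this ⊢
    by_cases hab : hA.eigenvalues a = hA.eigenvalues b
    · rw [hab, mul_comm]
    · have h3 : ((hA.eigenvalues a : ℂ) - hA.eigenvalues b) * (star U * B * U) a b = 0 := by
        rw [sub_mul, this]; ring
      have h4 : ((hA.eigenvalues a : ℂ) - hA.eigenvalues b) ≠ 0 := by
        rw [sub_ne_zero]; exact_mod_cast hab
      rw [(mul_eq_zero.1 h3).resolve_left h4]; simp
  calc _ = U * (diagonal (fun i => (f (hA.eigenvalues i) : ℂ)) * (star U * B * U)) * star U := by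
        simp only [mul_assoc, hUU, mul_one]
    _ = _ := by rw [h2]; simp only [← mul_assoc, hUU, one_mul]

theorem aux_cfc_herm (A : Matrix ι ι ℂ) (hA : A.IsHermitian) (f : ℝ → ℝ) :
    (matCFC f A)ᴴ = matCFC f A := by
  simp only [matCFC, dif_pos hA]
  rw [conjTranspose_mul, conjTranspose_mul, diagonal_conjTranspose, star_eq_conjTranspose,
    conjTranspose_conjTranspose, ← mul_assoc]
  congr 3
  ext i; simp

theorem aux_cfc_sum (A : Matrix ι ι ℂ) (hA : A.IsHermitian) (g : ℝ → ℝ) :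
    ∑ c : Finset.univ.image hA.eigenvalues,
      (g c : ℂ) • matCFC (fun x => if x = (c : ℝ) then 1 else 0) A = matCFC g A := by
  simp only [matCFC, dif_pos hA]
  set U : Matrix ι ι ℂ := (hA.eigenvectorUnitary : Matrix ι ι ℂ) with hU
  have : ∀ c : Finset.univ.image hA.eigenvalues, (g c : ℂ) • (U *
      diagonal (fun i => (((if hA.eigenvalues i = (c : ℝ) then 1 else 0 : ℝ)) : ℂ)) * star U) =
      U * (diagonal (fun i => (((if hA.eigenvalues i = (c : ℝ) then g c else 0 : ℝ)) : ℂ))) *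
        star U := by
    intro c
    rw [← smul_mul_assoc, ← mul_smul_comm, ← diagonal_smul]
    congr 3
    ext i
    by_cases h : hA.eigenvalues i = c <;> simp [h]
  simp_rw [this]
  rw [← Finset.sum_mul, ← Finset.mul_sum]
  congr 2
  ext a b
  rw [Matrix.sum_apply]
  by_cases hab : a = b
  · subst hab
    simp only [diagonal_apply_eq]
    rw [← Complex.ofReal_sum]
    congr 1
    rw [Finset.sum_coe_sort (Finset.univ.image hA.eigenvalues)
      (fun c => if hA.eigenvalues a = c then g c else 0)]
    simp
  · simp [diagonal_apply_ne _ hab]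

theorem aux_cfc_one (A : Matrix ι ι ℂ) (hA : A.IsHermitian) : matCFC (fun _ => 1) A = 1 := by
  simp only [matCFC, dif_pos hA]
  have hUU := Unitary.mul_star_self_of_mem hA.eigenvectorUnitary.2
  simp [-Unitary.coe_star]

theorem aux_cfc_mul_proj (A : Matrix ι ι ℂ) (hA : A.IsHermitian) (c : ℝ) :
    A * matCFC (fun x => if x = c then 1 else 0) A =
      (c : ℂ) • matCFC (fun x => if x = c then 1 else 0) A := by
  have := aux_tr_mul_log A hA (fun x => x) (fun x => if x = c then 1 else 0)
  rw [aux_cfc_id A hA] at this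
  rw [this]
  simp only [matCFC, dif_pos hA]
  rw [← smul_mul_assoc, ← mul_smul_comm, ← diagonal_smul]
  congr 3
  ext i
  by_cases h : hA.eigenvalues i = c <;> simp [h]

theorem aux_backward (σ ρ : Matrix ι ι ℂ) (hσ : IsState σ)
    (hρpd : ρ.PosDef) (h : σ * ρ = ρ * σ) :
    ∃ M : (Finset.univ.image hσ.1.1.eigenvalues) × (Finset.univ.image hρpd.1.eigenvalues) →
      Matrix ι ι ℂ, IsPOVM M ∧ Dm M σ ρ = qRelEnt σ ρ := by
  set P : ℝ → Matrix ι ι ℂ := fun c => matCFC (fun x => if x = c then 1 else 0) σ with hP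
  set Q : ℝ → Matrix ι ι ℂ := fun c => matCFC (fun x => if x = c then 1 else 0) ρ with hQ
  have hcomm : ∀ c e, P c * Q e = Q e * P c := by
    intro c e
    apply aux_cfc_comm σ _ hσ.1.1
    exact (aux_cfc_comm ρ σ hρpd.1 _ h.symm).symm
  have hPP : ∀ c, P c * P c = P c := by
    intro c
    simp only [hP]
    rw [aux_tr_mul_log σ hσ.1.1]
    congr 1; ext x; simp
  have hQQ : ∀ c, Q c * Q c = Q c := by
    intro c
    simp only [hQ]
    rw [aux_tr_mul_log ρ hρpd.1]
    congr 1; ext x; simp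
  have hPH : ∀ c, (P c)ᴴ = P c := fun c => aux_cfc_herm σ hσ.1.1 _
  have hQH : ∀ c, (Q c)ᴴ = Q c := fun c => aux_cfc_herm ρ hρpd.1 _
  have hP1 : ∑ c : Finset.univ.image hσ.1.1.eigenvalues, P c = 1 := by
    have := aux_cfc_sum σ hσ.1.1 (fun _ => 1)
    rw [aux_cfc_one σ hσ.1.1] at this
    simpa using this
  have hQ1 : ∑ c : Finset.univ.image hρpd.1.eigenvalues, Q c = 1 := by
    have := aux_cfc_sum ρ hρpd.1 (fun _ => 1)
    rw [aux_cfc_one ρ hρpd.1] at this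
    simpa using this
  have hPl : ∑ c : Finset.univ.image hσ.1.1.eigenvalues, (Real.log c : ℂ) • P c = matLog σ :=
    aux_cfc_sum σ hσ.1.1 Real.log
  have hQl : ∑ c : Finset.univ.image hρpd.1.eigenvalues, (Real.log c : ℂ) • Q c = matLog ρ :=
    aux_cfc_sum ρ hρpd.1 Real.log
  refine ⟨fun x => P x.1 * Q x.2, ⟨?_, ?_⟩, ?_⟩
  · intro x
    have := posSemidef_conjTranspose_mul_self (P x.1 * Q x.2)
    have e : (P x.1 * Q x.2)ᴴ * (P x.1 * Q x.2) = P x.1 * Q x.2 := by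
      rw [conjTranspose_mul, hPH, hQH]
      calc Q x.2 * P x.1 * (P x.1 * Q x.2) = Q x.2 * (P x.1 * P x.1) * Q x.2 := by
            simp only [mul_assoc]
        _ = P x.1 * (Q x.2 * Q x.2) := by rw [hPP, ← hcomm, mul_assoc]
        _ = _ := by rw [hQQ]
    rwa [e] at this
  · rw [Fintype.sum_prod_type]
    simp_rw [← Finset.mul_sum, hQ1, mul_one, hP1]
  · have e1 : matLog σ - matLog ρ = ∑ x : (Finset.univ.image hσ.1.1.eigenvalues) ×
        (Finset.univ.image hρpd.1.eigenvalues),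
        ((Real.log x.1 - Real.log x.2 : ℝ) : ℂ) • (P x.1 * Q x.2) := by
      simp_rw [Complex.ofReal_sub, sub_smul]
      rw [Finset.sum_sub_distrib, Fintype.sum_prod_type, Fintype.sum_prod_type_right]
      simp_rw [← smul_mul_assoc, ← Finset.mul_sum, hQ1, mul_one, hPl]
      simp_rw [smul_mul_assoc, ← mul_smul_comm, ← Finset.sum_mul, hP1, one_mul, hQl]
    unfold qRelEnt Dm klDiv
    rw [e1, Finset.mul_sum, trace_sum, Complex.re_sum]
    apply Finset.sum_congr rfl
    rintro ⟨⟨c, hc⟩, ⟨e, he⟩⟩ _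
    have he0 : 0 < e := by
      obtain ⟨i, _, rfl⟩ := Finset.mem_image.1 he
      exact hρpd.eigenvalues_pos i
    simp only
    have hp : probOf (P c * Q e) σ = c * (P c * Q e).trace.re := by
      unfold probOf
      rw [trace_mul_comm, ← mul_assoc, aux_cfc_mul_proj σ hσ.1.1, smul_mul_assoc, trace_smul,
        smul_eq_mul, Complex.re_ofReal_mul]
    have hq : probOf (P c * Q e) ρ = e * (P c * Q e).trace.re := by
      unfold probOf
      rw [hcomm, trace_mul_comm, ← mul_assoc, aux_cfc_mul_proj ρ hρpd.1, smul_mul_assoc,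
        trace_smul, smul_eq_mul, Complex.re_ofReal_mul]
    rw [mul_smul_comm, trace_smul, smul_eq_mul, Complex.re_ofReal_mul, trace_mul_comm]
    change _ = _ * probOf (P c * Q e) σ
    rw [hp, hq]
    by_cases h1 : (P c * Q e).trace.re = 0
    · simp [h1]
    by_cases h2 : c = 0
    · simp [h2]
    rw [mul_div_mul_right _ _ h1, Real.log_div h2 he0.ne']
    ring

end Mats

/-- For states `σ, ρ` with `ρ` positive definite, there is a POVM `M`
attaining `D_M(σ‖ρ) = D(σ‖ρ)` if and only if `σρ = ρσ`. -/
theorem statement6 (d : ℕ) (σ ρ : Matrix (Fin d) (Fin d) ℂ)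
    (hσ : IsState σ) (hρ : IsState ρ) (hρpd : ρ.PosDef) :
    (∃ (m : ℕ) (M : Fin m → Matrix (Fin d) (Fin d) ℂ),
        IsPOVM M ∧ Dm M σ ρ = qRelEnt σ ρ) ↔ σ * ρ = ρ * σ := by
  constructor
  · rintro ⟨m, M, hM, h⟩
    exact aux_forward σ ρ hσ hρpd M hM h
  · intro h
    obtain ⟨M, hM, h2⟩ := aux_backward σ ρ hσ hρpd h
    let e := (Fintype.equivFin ((Finset.univ.image hσ.1.1.eigenvalues) ×
      (Finset.univ.image hρpd.1.eigenvalues))).symm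
    refine ⟨_, fun i => M (e i), ⟨fun j => hM.1 _, ?_⟩, ?_⟩
    · rw [Equiv.sum_comp e M]; exact hM.2
    · rw [← h2]
      unfold Dm klDiv
      exact Equiv.sum_comp e
        (fun j => probOf (M j) σ * Real.log (probOf (M j) σ / probOf (M j) ρ))
end
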